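/- Let n be a positive integer and let T : 𝓢(M_n(ℝ), ℂ) → ℂ be a tempered distribution on the space M_n(ℝ) of n×n real matrices. Assume that T is invariant under conjugation, i.e. for every g ∈ GL_n(ℝ) and every Schwartz function φ one has T(x ↦ φ(g x g⁻¹)) = T(φ). Then T is invariant under transpose: T(x ↦ φ(xᵀ)) = T(φ) for every Schwartz function φ. -/

import Mathlib

/-!
Tempered-distribution form, over `k = ℝ`, of part (a) of Theorem D:
a conjugation-invariant tempered distribution on `Mₙ(ℝ)` is transpose-invariant.
-/

open SchwartzMap Matrix MeasureTheory
open scoped LineDeriv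

attribute [local instance] Matrix.normedAddCommGroup Matrix.normedSpace

/-- The action of the matrix unit `E i j` on the tensor slots `J` of a tensor `t`, in
coordinates. -/
def tensorUnit {ι κ A : Type*} [DecidableEq ι] [DecidableEq κ] [AddCommMonoid A]
    (J : Finset ι) (i j : κ) (t : (ι → κ) → A) (f : ι → κ) : A :=
  ∑ r ∈ J, if f r = i then t (Function.update f r j) else 0

section
variable {ι κ : Type*} [DecidableEq ι] [DecidableEq κ] [Fintype κ]

theorem sum_mul_tensorUnit [Fintype ι] (J : Finset ι) (i j : κ) (t u : (ι → κ) → ℝ) :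
    ∑ f, u f * tensorUnit J i j t f = ∑ f, tensorUnit J j i u f * t f := by
  simp only [tensorUnit, Finset.mul_sum, Finset.sum_mul]
  rw [Finset.sum_comm, Finset.sum_comm (s := Finset.univ)]
  refine Finset.sum_congr rfl fun r _ => ?_
  simp only [mul_ite, mul_zero, ite_mul, zero_mul]
  rw [← Finset.sum_filter, ← Finset.sum_filter]
  refine Finset.sum_bij' (fun f _ => Function.update f r j) (fun f _ => Function.update f r i)
    ?_ ?_ ?_ ?_ ?_
  · simp
  · simp
  · intro f hf
    simp only [Finset.mem_filter, Finset.mem_univ, true_and] at hf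
    simp [← hf]
  · intro f hf
    simp only [Finset.mem_filter, Finset.mem_univ, true_and] at hf
    simp [← hf]
  · intro f hf
    simp only [Finset.mem_filter, Finset.mem_univ, true_and] at hf
    simp [← hf]

theorem sum_tensorUnit_tensorUnit (J : Finset ι) (t : (ι → κ) → ℝ)
    (htr : ∀ r ∈ J, ∀ r' ∈ J, r ≠ r' → ∀ f : ι → κ,
      ∑ k, t (Function.update (Function.update f r k) r' k) = 0) (j : κ) (f : ι → κ) :
    ∑ i ∈ Finset.univ.erase j, tensorUnit J j i (tensorUnit J j i t) f =
      - (∑ r ∈ J, ∑ r' ∈ J, if r ≠ r' ∧ f r = j ∧ f r' = j then 1 else 0) * t f := by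
  simp only [tensorUnit]
  rw [Finset.sum_comm, neg_mul, Finset.sum_mul, ← Finset.sum_neg_distrib]
  refine Finset.sum_congr rfl fun r hr => ?_
  by_cases hfr : f r = j
  swap
  · simp [hfr]
  simp only [hfr, if_true]
  rw [Finset.sum_comm, Finset.sum_mul, ← Finset.sum_neg_distrib]
  refine Finset.sum_congr rfl fun r' hr' => ?_
  by_cases h : r' = r
  · subst h
    simp only [Function.update_self, ne_eq, not_true_eq_false, false_and, if_false, zero_mul,
      neg_zero]
    refine Finset.sum_eq_zero fun i hi => ?_
    rw [if_neg (Finset.ne_of_mem_erase hi)]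
  · simp only [Function.update_of_ne h]
    by_cases hfr' : f r' = j
    swap
    · simp [hfr']
    have key := htr r hr r' hr' (Ne.symm h) f
    rw [← Finset.add_sum_erase _ _ (Finset.mem_univ j)] at key
    have h1 : Function.update (Function.update f r j) r' j = f := by
      rw [← hfr, Function.update_eq_self, hfr, ← hfr', Function.update_eq_self]
    rw [h1] at key
    simp only [hfr', if_true, ne_eq, Ne.symm h, not_false_eq_true, and_self, one_mul]
    linarith

/-- A traceless tensor which is invariant under the Lie algebra of the orthogonal group and under
the coordinate reflections vanishes. -/
theorem eq_zero_of_traceless_of_orthogonal_invariant [Fintype ι] (J : Finset ι) (hJ : J.Nonempty)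
    (t : (ι → κ) → ℝ)
    (hso : ∀ i j f, tensorUnit J i j t f = tensorUnit J j i t f)
    (htr : ∀ r ∈ J, ∀ r' ∈ J, r ≠ r' → ∀ f : ι → κ,
      ∑ k, t (Function.update (Function.update f r k) r' k) = 0)
    (hrefl : ∀ (j : κ) (f : ι → κ), t f = (∏ r ∈ J, if f r = j then (-1 : ℝ) else 1) * t f)
    (f : ι → κ) : t f = 0 := by
  set N : κ → (ι → κ) → ℝ := fun j f =>
    ∑ r ∈ J, ∑ r' ∈ J, if r ≠ r' ∧ f r = j ∧ f r' = j then 1 else 0 with hN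
  have hN0 : ∀ j f, 0 ≤ N j f := fun j f =>
    Finset.sum_nonneg fun r _ => Finset.sum_nonneg fun r' _ => by split_ifs <;> norm_num
  have h1 : ∀ j, ∑ f, N j f * t f ^ 2 = 0 := by
    intro j
    have h2 : ∑ i ∈ Finset.univ.erase j, ∑ f, tensorUnit J i j t f ^ 2 =
        - ∑ f, N j f * t f ^ 2 := by
      have h3 : ∀ i, ∑ f, tensorUnit J i j t f ^ 2 =
          ∑ f, tensorUnit J j i (tensorUnit J j i t) f * t f := by
        intro i
        have : tensorUnit J i j t = tensorUnit J j i t := funext (hso i j)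
        rw [← sum_mul_tensorUnit, ← this]
        simp only [sq]
      simp only [h3]
      rw [Finset.sum_comm, ← Finset.sum_neg_distrib]
      refine Finset.sum_congr rfl fun f _ => ?_
      rw [← Finset.sum_mul, sum_tensorUnit_tensorUnit J t htr]
      ring
    have h4 : 0 ≤ ∑ i ∈ Finset.univ.erase j, ∑ f, tensorUnit J i j t f ^ 2 :=
      Finset.sum_nonneg fun i _ => Finset.sum_nonneg fun f _ => sq_nonneg _
    have h5 : 0 ≤ ∑ f, N j f * t f ^ 2 :=
      Finset.sum_nonneg fun f _ => mul_nonneg (hN0 j f) (sq_nonneg _)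
    linarith
  by_contra hf
  obtain ⟨r₀, hr₀⟩ := hJ
  have h6 : N (f r₀) f = 0 := by
    have := (Finset.sum_eq_zero_iff_of_nonneg
      fun g _ => mul_nonneg (hN0 (f r₀) g) (sq_nonneg (t g))).1 (h1 (f r₀)) f (Finset.mem_univ f)
    exact (mul_eq_zero.1 this).resolve_right (pow_ne_zero 2 hf)
  have h7 : ∀ r ∈ J, r ≠ r₀ → f r ≠ f r₀ := by
    intro r hr hne heq
    have h8 := (Finset.sum_eq_zero_iff_of_nonneg (fun r _ => Finset.sum_nonneg fun r' _ => by
      split_ifs <;> norm_num)).1 h6 r hr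
    have h9 := (Finset.sum_eq_zero_iff_of_nonneg (fun r' _ => by
      split_ifs <;> norm_num)).1 h8 r₀ hr₀
    simp [hne, heq] at h9
  have h8 := hrefl (f r₀) f
  rw [Finset.prod_eq_single r₀ (fun r hr hne => if_neg (h7 r hr hne)) (fun h => absurd hr₀ h),
    if_pos rfl] at h8
  apply hf
  linarith

/-- The complex version of `eq_zero_of_traceless_of_orthogonal_invariant`. -/
theorem complex_eq_zero_of_traceless_of_orthogonal_invariant [Fintype ι] (J : Finset ι)
    (hJ : J.Nonempty) (t : (ι → κ) → ℂ)
    (hso : ∀ i j f, tensorUnit J i j t f = tensorUnit J j i t f)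
    (htr : ∀ r ∈ J, ∀ r' ∈ J, r ≠ r' → ∀ f : ι → κ,
      ∑ k, t (Function.update (Function.update f r k) r' k) = 0)
    (hrefl : ∀ (j : κ) (f : ι → κ), t f = (∏ r ∈ J, if f r = j then (-1 : ℂ) else 1) * t f)
    (f : ι → κ) : t f = 0 := by
  have hprod : ∀ (j : κ) (f : ι → κ), (∏ r ∈ J, if f r = j then (-1 : ℂ) else 1) =
      ((∏ r ∈ J, if f r = j then (-1 : ℝ) else 1 : ℝ) : ℂ) := by
    intro j f
    simp [apply_ite Complex.ofReal]
  apply Complex.ext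
  · refine eq_zero_of_traceless_of_orthogonal_invariant J hJ (fun f => (t f).re) ?_ ?_ ?_ f
    · intro i j f
      have := congrArg Complex.re (hso i j f)
      simpa [tensorUnit, apply_ite Complex.re] using this
    · intro r hr r' hr' hne f
      simpa using congrArg Complex.re (htr r hr r' hr' hne f)
    · intro j f
      have := congrArg Complex.re (hrefl j f)
      rwa [hprod, Complex.re_ofReal_mul] at this
  · refine eq_zero_of_traceless_of_orthogonal_invariant J hJ (fun f => (t f).im) ?_ ?_ ?_ f
    · intro i j f
      have := congrArg Complex.im (hso i j f)
      simpa [tensorUnit, apply_ite Complex.im] using this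
    · intro r hr r' hr' hne f
      simpa using congrArg Complex.im (htr r hr r' hr' hne f)
    · intro j f
      have := congrArg Complex.im (hrefl j f)
      rwa [hprod, Complex.im_ofReal_mul] at this

end

section
variable {κ R : Type*} [CommRing R]

theorem map_derivation_mul [Fintype κ] [Algebra ℂ R] (δ : Derivation ℂ R R) (A B : Matrix κ κ R) :
    (A * B).map δ = A.map δ * B + A * B.map δ := by
  ext i j
  simp only [Matrix.map_apply, Matrix.mul_apply, map_sum, Derivation.leibniz, smul_eq_mul,
    Matrix.add_apply, ← Finset.sum_add_distrib]
  exact Finset.sum_congr rfl fun k _ => by ring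

variable [DecidableEq κ]

/-- The skew-symmetric matrix `E i j - E j i`. -/
def skewUnit (R : Type*) [CommRing R] (i j : κ) : Matrix κ κ R :=
  Matrix.single i j 1 - Matrix.single j i 1

/-- The reflection matrix in the `j`-th coordinate. -/
def reflectionMatrix (R : Type*) [CommRing R] (j : κ) : Matrix κ κ R :=
  Matrix.diagonal fun k => if k = j then -1 else 1

theorem skewUnit_transpose (i j : κ) : (skewUnit R i j)ᵀ = - skewUnit R i j := by
  simp [skewUnit]

variable [Fintype κ]

/-- The word `X ^ a * Xᵀ ^ b` in a matrix and its transpose. -/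
def transposeWord (X : Matrix κ κ R) (a b : ℕ) : Matrix κ κ R := X ^ a * Xᵀ ^ b

theorem transposeWord_transpose (X : Matrix κ κ R) (a b : ℕ) :
    (transposeWord X a b)ᵀ = transposeWord X b a := by
  simp [transposeWord, Matrix.transpose_mul, Matrix.transpose_pow]

theorem transposeWord_apply_swap (X : Matrix κ κ R) (a b : ℕ) (i j : κ) :
    transposeWord X a b i j = transposeWord X b a j i := by
  rw [← transposeWord_transpose X b a]; rfl

theorem skewUnit_mul_sub_mul_apply (W : Matrix κ κ R) (i j k l : κ) :
    (skewUnit R i j * W - W * skewUnit R i j) k l =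
      ((if k = i then W j l else 0) + (if l = i then W k j else 0)) -
      ((if k = j then W i l else 0) + (if l = j then W k i else 0)) := by
  have h1 : ∀ (i j k l : κ), (Matrix.single i j (1 : R) * W) k l = if k = i then W j l else 0 := by
    intro i j k l
    split_ifs with h
    · subst h; simp
    · simp [h]
  have h2 : ∀ (i j k l : κ), (W * Matrix.single i j (1 : R)) k l = if l = j then W k i else 0 := by
    intro i j k l
    split_ifs with h
    · subst h; simp
    · simp [h]
  simp only [skewUnit, sub_mul, mul_sub, Matrix.sub_apply, h1, h2]
  ring

theorem reflectionMatrix_mul_self (j : κ) :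
    reflectionMatrix R j * reflectionMatrix R j = 1 := by
  rw [reflectionMatrix, Matrix.diagonal_mul_diagonal, ← Matrix.diagonal_one]
  congr 1
  ext k
  split_ifs <;> simp

theorem reflectionMatrix_conj_apply (W : Matrix κ κ R) (j k l : κ) :
    (reflectionMatrix R j * W * reflectionMatrix R j) k l =
      (if k = j then -1 else 1) * (if l = j then -1 else 1) * W k l := by
  rw [reflectionMatrix, Matrix.mul_diagonal, Matrix.diagonal_mul]
  ring

variable [Algebra ℂ R]

theorem map_transposeWord_of_commutator {δ : Derivation ℂ R R} {X Z : Matrix κ κ R}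
    (hZ : Zᵀ = -Z) (hX : X.map δ = Z * X - X * Z) (a b : ℕ) :
    (transposeWord X a b).map δ = Z * transposeWord X a b - transposeWord X a b * Z := by
  have hmul : ∀ A B : Matrix κ κ R, A.map δ = Z * A - A * Z → B.map δ = Z * B - B * Z →
      (A * B).map δ = Z * (A * B) - (A * B) * Z := by
    intro A B hA hB
    rw [map_derivation_mul, hA, hB]
    noncomm_ring
  have hpow : ∀ (A : Matrix κ κ R) (m : ℕ), A.map δ = Z * A - A * Z →
      (A ^ m).map δ = Z * A ^ m - A ^ m * Z := by
    intro A m hA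
    induction m with
    | zero =>
      ext i j
      by_cases h : i = j <;> simp [h]
    | succ m ih =>
      rw [pow_succ]
      exact hmul _ _ ih hA
  have hXt : Xᵀ.map δ = Z * Xᵀ - Xᵀ * Z := by
    rw [Matrix.transpose_map, hX, Matrix.transpose_sub, Matrix.transpose_mul,
      Matrix.transpose_mul, hZ]
    noncomm_ring
  exact hmul _ _ (hpow _ a hX) (hpow _ b hXt)

theorem map_transposeWord_of_conj {δ : R →ₐ[ℂ] R} {X D : Matrix κ κ R}
    (hD : Dᵀ = D) (hDD : D * D = 1) (hX : X.map δ = D * X * D) (a b : ℕ) :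
    (transposeWord X a b).map δ = D * transposeWord X a b * D := by
  have hmul : ∀ A B : Matrix κ κ R, A.map δ = D * A * D → B.map δ = D * B * D →
      (A * B).map δ = D * (A * B) * D := by
    intro A B hA hB
    rw [Matrix.map_mul, hA, hB]
    calc D * A * D * (D * B * D) = D * A * (D * D) * B * D := by noncomm_ring
      _ = _ := by rw [hDD]; noncomm_ring
  have hpow : ∀ (A : Matrix κ κ R) (m : ℕ), A.map δ = D * A * D →
      (A ^ m).map δ = D * A ^ m * D := by
    intro A m hA
    induction m with
    | zero => simp [hDD]
    | succ m ih =>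
      rw [pow_succ]
      exact hmul _ _ ih hA
  have hXt : Xᵀ.map δ = D * Xᵀ * D := by
    rw [Matrix.transpose_map, hX, Matrix.transpose_mul, Matrix.transpose_mul, hD, mul_assoc]
  exact hmul _ _ (hpow _ a hX) (hpow _ b hXt)

theorem map_trace_transposeWord_of_transpose {δ : R →ₐ[ℂ] R} {X : Matrix κ κ R}
    (hX : X.map δ = Xᵀ) (a b : ℕ) :
    δ (transposeWord X a b).trace = (transposeWord X a b).trace := by
  have hXt : Xᵀ.map δ = X := by rw [Matrix.transpose_map, hX, Matrix.transpose_transpose]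
  have h1 : δ (transposeWord X a b).trace = (δ.mapMatrix (transposeWord X a b)).trace := by
    simp [Matrix.trace]
  rw [h1, transposeWord, map_mul, map_pow, map_pow, AlgHom.mapMatrix_apply, AlgHom.mapMatrix_apply,
    hX, hXt, ← Matrix.trace_transpose, Matrix.transpose_mul, Matrix.transpose_pow,
    Matrix.transpose_pow, Matrix.transpose_transpose, Matrix.trace_mul_comm]

/-- Modulo the entries of `X * Xᵀ - Xᵀ * X`, words in `X` and `Xᵀ` can be reordered. -/
theorem eq_zero_mul_transposeWord_mul {X : Matrix κ κ R} (ℓ : R →ₗ[ℂ] ℂ)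
    (hC : ∀ (Q : R) (i j : κ), ℓ (Q * (X * Xᵀ - Xᵀ * X) i j) = 0) (Q : R) (a b c d : ℕ) (i j : κ) :
    ℓ (Q * (transposeWord X a b * transposeWord X c d) i j) =
      ℓ (Q * transposeWord X (a + c) (b + d) i j) := by
  set I : Ideal R := Ideal.span (Set.range fun p : κ × κ => (X * Xᵀ - Xᵀ * X) p.1 p.2) with hI
  have hℓ : ∀ x ∈ I, ∀ Q, ℓ (Q * x) = 0 := by
    intro x hx
    induction hx using Submodule.span_induction with
    | mem x hx => obtain ⟨p, rfl⟩ := hx; exact fun Q => hC Q _ _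
    | zero => simp
    | add x y _ _ h1 h2 => intro Q; rw [mul_add, map_add, h1, h2, add_zero]
    | smul r x _ h => intro Q; rw [smul_eq_mul, ← mul_assoc]; exact h _
  have hcomm : Commute ((Ideal.Quotient.mk I).mapMatrix X)
      ((Ideal.Quotient.mk I).mapMatrix Xᵀ) := by
    rw [commute_iff_eq, ← map_mul, ← map_mul]
    ext k l
    rw [RingHom.mapMatrix_apply, RingHom.mapMatrix_apply, Matrix.map_apply, Matrix.map_apply,
      Ideal.Quotient.eq]
    exact Ideal.subset_span ⟨(k, l), rfl⟩
  have hmem : (transposeWord X a b * transposeWord X c d) i j -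
      transposeWord X (a + c) (b + d) i j ∈ I := by
    rw [← Ideal.Quotient.eq]
    have : (Ideal.Quotient.mk I).mapMatrix (transposeWord X a b * transposeWord X c d) =
        (Ideal.Quotient.mk I).mapMatrix (transposeWord X (a + c) (b + d)) := by
      simp only [transposeWord, map_mul, map_pow]
      rw [mul_assoc, ← mul_assoc (_ ^ b), ((hcomm.symm.pow_pow b c)).eq, pow_add, pow_add]
      noncomm_ring
    exact congrFun (congrFun this i) j
  have := hℓ _ hmem Q
  rwa [mul_sub, map_sub, sub_eq_zero] at this

end

theorem Derivation.map_finset_prod {R A ι : Type*} [CommRing R] [CommRing A] [Algebra R A]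
    [DecidableEq ι] (δ : Derivation R A A) (S : Finset ι) (u : ι → A) :
    δ (∏ p ∈ S, u p) = ∑ p ∈ S, (∏ q ∈ S.erase p, u q) * δ (u p) := by
  induction S using Finset.induction_on with
  | empty => simp
  | insert p S hp ih =>
    rw [Finset.prod_insert hp, Derivation.leibniz, ih, Finset.sum_insert hp,
      Finset.erase_insert hp, smul_eq_mul, smul_eq_mul, Finset.mul_sum, add_comm]
    congr 1
    refine Finset.sum_congr rfl fun q hq => ?_
    have hpq : p ≠ q := fun h => hp (h ▸ hq)
    rw [Finset.erase_insert_of_ne hpq, Finset.prod_insert (fun h => hp (Finset.mem_of_mem_erase h)),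
      mul_assoc]

section
variable {P κ R : Type*} [DecidableEq κ] [Fintype κ] [CommRing R]

/-- The product over `S` of the entries of the words `Xᵃ(Xᵀ)ᵇ`, as a tensor. -/
def wordProd (X : Matrix κ κ R) (S : Finset P) (a b : P → ℕ) (f : P ⊕ P → κ) : R :=
  ∏ p ∈ S, transposeWord X (a p) (b p) (f (Sum.inl p)) (f (Sum.inr p))

theorem wordProd_congr {X : Matrix κ κ R} {S : Finset P} {a a' b b' : P → ℕ} {f f' : P ⊕ P → κ}
    (ha : ∀ p ∈ S, a p = a' p) (hb : ∀ p ∈ S, b p = b' p)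
    (hl : ∀ p ∈ S, f (Sum.inl p) = f' (Sum.inl p)) (hr : ∀ p ∈ S, f (Sum.inr p) = f' (Sum.inr p)) :
    wordProd X S a b f = wordProd X S a' b' f' :=
  Finset.prod_congr rfl fun p hp => by rw [ha p hp, hb p hp, hl p hp, hr p hp]

variable [DecidableEq P]

theorem wordProd_eq_erase_mul (X : Matrix κ κ R) {S : Finset P} {p : P} (hp : p ∈ S)
    (a b : P → ℕ) (f : P ⊕ P → κ) :
    wordProd X S a b f = wordProd X (S.erase p) a b f *
      transposeWord X (a p) (b p) (f (Sum.inl p)) (f (Sum.inr p)) := by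
  rw [wordProd, ← Finset.prod_erase_mul _ _ hp]; rfl

theorem wordProd_erase_update (X : Matrix κ κ R) (S : Finset P) (p : P)
    (a b : P → ℕ) (f : P ⊕ P → κ) (k : κ) :
    wordProd X (S.erase p) a b (Function.update f (Sum.inl p) k) = wordProd X (S.erase p) a b f ∧
    wordProd X (S.erase p) a b (Function.update f (Sum.inr p) k) =
      wordProd X (S.erase p) a b f := by
  constructor <;> refine wordProd_congr (fun _ _ => rfl) (fun _ _ => rfl) ?_ ?_ <;>
    intro q hq <;> simp [Finset.ne_of_mem_erase hq]

theorem wordProd_update_inl (X : Matrix κ κ R) {S : Finset P} {p : P} (hp : p ∈ S)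
    (a b : P → ℕ) (f : P ⊕ P → κ) (k : κ) :
    wordProd X S a b (Function.update f (Sum.inl p) k) = wordProd X (S.erase p) a b f *
      transposeWord X (a p) (b p) k (f (Sum.inr p)) := by
  rw [wordProd_eq_erase_mul X hp, (wordProd_erase_update X S p a b f k).1]
  simp

theorem wordProd_update_inr (X : Matrix κ κ R) {S : Finset P} {p : P} (hp : p ∈ S)
    (a b : P → ℕ) (f : P ⊕ P → κ) (k : κ) :
    wordProd X S a b (Function.update f (Sum.inr p) k) = wordProd X (S.erase p) a b f *
      transposeWord X (a p) (b p) (f (Sum.inl p)) k := by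
  rw [wordProd_eq_erase_mul X hp, (wordProd_erase_update X S p a b f k).2]
  simp

variable [Algebra ℂ R]

theorem map_wordProd_of_commutator {δ : Derivation ℂ R R} {X : Matrix κ κ R} {i j : κ}
    (hX : X.map δ = skewUnit R i j * X - X * skewUnit R i j) (S : Finset P) (a b : P → ℕ)
    (f : P ⊕ P → κ) :
    δ (wordProd X S a b f) = tensorUnit (S.disjSum S) i j (wordProd X S a b) f -
      tensorUnit (S.disjSum S) j i (wordProd X S a b) f := by
  have hw : ∀ (p : P) (k l : κ), δ (transposeWord X (a p) (b p) k l) = _ := fun p k l =>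
    (congrFun (congrFun (map_transposeWord_of_commutator (skewUnit_transpose i j) hX (a p) (b p))
      k) l).trans (skewUnit_mul_sub_mul_apply _ i j k l)
  have hunit : ∀ i j, tensorUnit (S.disjSum S) i j (wordProd X S a b) f =
      ∑ p ∈ S, wordProd X (S.erase p) a b f *
        ((if f (Sum.inl p) = i then transposeWord X (a p) (b p) j (f (Sum.inr p)) else 0) +
        (if f (Sum.inr p) = i then transposeWord X (a p) (b p) (f (Sum.inl p)) j else 0)) := by
    intro i j
    rw [tensorUnit, Finset.sum_disjSum, ← Finset.sum_add_distrib]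
    refine Finset.sum_congr rfl fun p hp => ?_
    rw [wordProd_update_inl X hp, wordProd_update_inr X hp]
    simp only [mul_add, mul_ite, mul_zero]
  rw [hunit, hunit, ← Finset.sum_sub_distrib, wordProd, Derivation.map_finset_prod]
  refine Finset.sum_congr rfl fun p hp => ?_
  rw [hw, ← mul_sub]
  rfl

omit [DecidableEq P] in
theorem map_wordProd_of_reflection {δ : R →ₐ[ℂ] R} {X : Matrix κ κ R} {j : κ}
    (hX : X.map δ = reflectionMatrix R j * X * reflectionMatrix R j) (S : Finset P) (a b : P → ℕ)
    (f : P ⊕ P → κ) :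
    δ (wordProd X S a b f) =
      (∏ r ∈ S.disjSum S, if f r = j then (-1 : ℂ) else 1) • wordProd X S a b f := by
  have hw : ∀ (p : P) (k l : κ), δ (transposeWord X (a p) (b p) k l) = _ := fun p k l =>
    (congrFun (congrFun (map_transposeWord_of_conj (by simp [reflectionMatrix])
      (reflectionMatrix_mul_self j) hX (a p) (b p)) k) l).trans
      (reflectionMatrix_conj_apply _ j k l)
  rw [Algebra.smul_def, map_prod, Finset.prod_disjSum, ← Finset.prod_mul_distrib, wordProd,
    map_prod, ← Finset.prod_mul_distrib]
  refine Finset.prod_congr rfl fun p _ => ?_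
  rw [hw]
  congr 1
  congr 1 <;> split_ifs <;> simp

/-- If a linear functional `ℓ` is invariant under the orthogonal group (Lie algebra and
reflections), changes sign under transposition and kills the ideal generated by `XXᵀ - XᵀX`, then
it kills all monomials in the entries of `X`. -/
theorem eq_zero_mul_wordProd [Fintype P] {X : Matrix κ κ R} (ℓ : R →ₗ[ℂ] ℂ)
    (τ : R →ₐ[ℂ] R) (σ : κ → R →ₐ[ℂ] R) (δ : κ → κ → Derivation ℂ R R)
    (hτX : X.map τ = Xᵀ)
    (hσX : ∀ j, X.map (σ j) = reflectionMatrix R j * X * reflectionMatrix R j)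
    (hδX : ∀ i j, X.map (δ i j) = skewUnit R i j * X - X * skewUnit R i j)
    (hC : ∀ (Q : R) (i j : κ), ℓ (Q * (X * Xᵀ - Xᵀ * X) i j) = 0)
    (hτ : ∀ Q, ℓ (τ Q) = - ℓ Q) (hσ : ∀ j Q, ℓ (σ j Q) = ℓ Q) (hδ : ∀ i j Q, ℓ (δ i j Q) = 0)
    (m : ℕ) : ∀ (S : Finset P), S.card = m → ∀ (a b : P → ℕ) (s : R), τ s = s →
      (∀ j, σ j s = s) → (∀ i j, δ i j s = 0) → ∀ f, ℓ (s * wordProd X S a b f) = 0 := by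
  induction m with
  | zero =>
    intro S hS a b s hτs _ _ f
    rw [Finset.card_eq_zero] at hS
    subst hS
    have := hτ s
    rw [hτs] at this
    rw [wordProd, Finset.prod_empty, mul_one]
    exact self_eq_neg.1 this
  | succ m ih =>
    intro S hS a b s hτs hσs hδs f
    have hcard : ∀ p ∈ S, (S.erase p).card = m := fun p hp => by
      rw [Finset.card_erase_of_mem hp, hS]; rfl
    have hSne : S.Nonempty := Finset.card_pos.1 (by omega)
    have hself : ∀ p ∈ S, ∀ f : P ⊕ P → κ,
        ℓ (s * (wordProd X (S.erase p) a b f * (transposeWord X (a p) (b p)).trace)) = 0 := by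
      intro p hp f
      have := ih (S.erase p) (hcard p hp) a b (s * (transposeWord X (a p) (b p)).trace)
        (by rw [map_mul, hτs, map_trace_transposeWord_of_transpose hτX]) ?_ ?_ f
      · rwa [mul_assoc, mul_comm _ (wordProd _ _ _ _ _)] at this
      · intro j
        have h1 : σ j (transposeWord X (a p) (b p)).trace =
            ((transposeWord X (a p) (b p)).map (σ j)).trace := by
          simp [Matrix.trace]
        rw [map_mul, hσs, h1, map_transposeWord_of_conj (by simp [reflectionMatrix])
          (reflectionMatrix_mul_self j) (hσX j), Matrix.trace_mul_comm, ← mul_assoc,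
          reflectionMatrix_mul_self, one_mul]
      · intro i j
        have h1 : δ i j (transposeWord X (a p) (b p)).trace =
            ((transposeWord X (a p) (b p)).map (δ i j)).trace := by
          simp [Matrix.trace]
        rw [Derivation.leibniz, hδs, h1,
          map_transposeWord_of_commutator (skewUnit_transpose i j) (hδX i j), Matrix.trace_sub,
          Matrix.trace_mul_comm, sub_self, smul_zero, smul_zero, add_zero]
    have hmerge : ∀ p ∈ S, ∀ q ∈ S, p ≠ q → ∀ (c d c' d' : ℕ) (x y : κ) (f : P ⊕ P → κ),
        ∑ k, ℓ (s * (wordProd X ((S.erase p).erase q) a b f *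
          (transposeWord X c d x k * transposeWord X c' d' k y))) = 0 := by
      intro p hp q hq hpq c d c' d' x y f
      rw [← map_sum, ← Finset.mul_sum, ← Finset.mul_sum, ← Matrix.mul_apply, ← mul_assoc,
        eq_zero_mul_transposeWord_mul ℓ hC, mul_assoc]
      have hq' : q ∈ S.erase p := Finset.mem_erase.2 ⟨hpq.symm, hq⟩
      have := ih (S.erase p) (hcard p hp) (Function.update a q (c + c'))
        (Function.update b q (d + d')) s hτs hσs hδs
        (Function.update (Function.update f (Sum.inl q) x) (Sum.inr q) y)
      rw [wordProd_eq_erase_mul X hq'] at this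
      convert this using 4
      · refine wordProd_congr ?_ ?_ ?_ ?_ <;> intro r hr <;> simp [Finset.ne_of_mem_erase hr]
      · simp
    have herase : ∀ p ∈ S, ∀ q ∈ S, p ≠ q → ∀ f : P ⊕ P → κ, wordProd X S a b f =
        wordProd X ((S.erase p).erase q) a b f *
          (transposeWord X (a p) (b p) (f (Sum.inl p)) (f (Sum.inr p)) *
            transposeWord X (a q) (b q) (f (Sum.inl q)) (f (Sum.inr q))) := by
      intro p hp q hq hpq f
      rw [wordProd_eq_erase_mul X hp,
        wordProd_eq_erase_mul X (Finset.mem_erase.2 ⟨hpq.symm, hq⟩)]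
      ring
    have hcongr : ∀ (p q : P) (f g : P ⊕ P → κ),
        (∀ r, r ≠ p → r ≠ q → f (Sum.inl r) = g (Sum.inl r) ∧ f (Sum.inr r) = g (Sum.inr r)) →
        wordProd X ((S.erase p).erase q) a b f = wordProd X ((S.erase p).erase q) a b g := by
      intro p q f g h
      refine wordProd_congr (fun _ _ => rfl) (fun _ _ => rfl) ?_ ?_ <;> intro r hr <;>
        rw [Finset.mem_erase, Finset.mem_erase] at hr
      · exact (h r hr.2.1 hr.1).1
      · exact (h r hr.2.1 hr.1).2
    refine complex_eq_zero_of_traceless_of_orthogonal_invariant (S.disjSum S)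
      (Finset.Nonempty.mono (t := S.disjSum S) (s := S.disjSum ∅)
        (Finset.disjSum_mono subset_rfl (Finset.empty_subset _)) (by simpa using hSne))
      (fun f => ℓ (s * wordProd X S a b f)) ?_ ?_ ?_ f
    · intro i j f
      have h1 := hδ i j (s * wordProd X S a b f)
      rw [Derivation.leibniz, hδs, smul_zero, add_zero, smul_eq_mul,
        map_wordProd_of_commutator (hδX i j), mul_sub, map_sub, sub_eq_zero] at h1
      simpa only [tensorUnit, Finset.mul_sum, map_sum, mul_ite, mul_zero, apply_ite ℓ, map_zero]
        using h1
    · have hsymm : ∀ r r' : P ⊕ P, r ≠ r' → ∀ f : P ⊕ P → κ,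
          (∑ k, ℓ (s * wordProd X S a b (Function.update (Function.update f r k) r' k))) =
          ∑ k, ℓ (s * wordProd X S a b (Function.update (Function.update f r' k) r k)) :=
        fun r r' h f => Finset.sum_congr rfl fun k _ => by rw [Function.update_comm h]
      have hlr : ∀ p ∈ S, ∀ q ∈ S, ∀ f : P ⊕ P → κ,
          ∑ k, ℓ (s * wordProd X S a b
            (Function.update (Function.update f (Sum.inl p) k) (Sum.inr q) k)) = 0 := by
        intro p hp q hq f
        by_cases hpq : p = q
        · subst hpq
          simp only [wordProd_update_inr X hp]
          simp only [(wordProd_erase_update X S p a b f _).1, Function.update_self]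
          rw [← map_sum, ← Finset.mul_sum, ← Finset.mul_sum]
          exact hself p hp f
        · have := hmerge q hq p hp (Ne.symm hpq) (a q) (b q) (a p) (b p) (f (Sum.inl q))
            (f (Sum.inr p)) f
          rw [← this]
          refine Finset.sum_congr rfl fun k _ => ?_
          rw [herase q hq p hp (Ne.symm hpq)]
          congr 3
          · apply hcongr; intro r h1 h2; simp [h1, h2]
          · simp [hpq, Ne.symm hpq]
      rintro (p | p) hp (q | q) hq hne f
      · have hpq : p ≠ q := fun h => hne (h ▸ rfl)
        rw [Finset.inl_mem_disjSum] at hp hq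
        have := hmerge p hp q hq hpq (b p) (a p) (a q) (b q) (f (Sum.inr p)) (f (Sum.inr q)) f
        rw [← this]
        refine Finset.sum_congr rfl fun k _ => ?_
        rw [herase p hp q hq hpq, transposeWord_apply_swap X (a p)]
        congr 3
        · apply hcongr; intro r h1 h2; simp [h1, h2]
        · simp [hpq]
      · exact hlr p (Finset.inl_mem_disjSum.1 hp) q (Finset.inr_mem_disjSum.1 hq) f
      · rw [hsymm _ _ hne]
        exact hlr q (Finset.inl_mem_disjSum.1 hq) p (Finset.inr_mem_disjSum.1 hp) f
      · have hpq : p ≠ q := fun h => hne (h ▸ rfl)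
        rw [Finset.inr_mem_disjSum] at hp hq
        have := hmerge p hp q hq hpq (a p) (b p) (b q) (a q) (f (Sum.inl p)) (f (Sum.inl q)) f
        rw [← this]
        refine Finset.sum_congr rfl fun k _ => ?_
        rw [herase p hp q hq hpq, transposeWord_apply_swap X (a q)]
        congr 3
        · apply hcongr; intro r h1 h2; simp [h1, h2]
        · simp [hpq]
    · intro j f
      have h1 := hσ j (s * wordProd X S a b f)
      rw [map_mul, hσs, map_wordProd_of_reflection (hσX j), mul_smul_comm, map_smul,
        smul_eq_mul] at h1
      exact h1.symm

end

section
variable {κ : Type*} [Fintype κ] [DecidableEq κ]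

/-- The derivation of the polynomial ring on matrices given by commutation of the generic matrix
with the matrix unit `E i j`. -/
noncomputable def commutatorDerivation (i j : κ) :
    Derivation ℂ (MvPolynomial (κ × κ) ℂ) (MvPolynomial (κ × κ) ℂ) :=
  ∑ p : κ × κ, (Matrix.single i j 1 * Matrix.mvPolynomialX κ κ ℂ -
    Matrix.mvPolynomialX κ κ ℂ * Matrix.single i j 1 : Matrix κ κ (MvPolynomial (κ × κ) ℂ))
      p.1 p.2 • MvPolynomial.pderiv p

/-- The action of the reflection in the `j`-th coordinate on polynomials on matrices. -/
noncomputable def reflectionHom (j : κ) :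
    MvPolynomial (κ × κ) ℂ →ₐ[ℂ] MvPolynomial (κ × κ) ℂ :=
  MvPolynomial.aeval fun p => (reflectionMatrix _ j * Matrix.mvPolynomialX κ κ ℂ *
    reflectionMatrix _ j : Matrix κ κ (MvPolynomial (κ × κ) ℂ)) p.1 p.2

/-- The action of transposition on polynomials on matrices. -/
noncomputable def transposeHom (κ : Type*) :
    MvPolynomial (κ × κ) ℂ →ₐ[ℂ] MvPolynomial (κ × κ) ℂ :=
  MvPolynomial.rename Prod.swap

/-- The commutator of the generic matrix and its transpose. -/
noncomputable def genericCommutator (κ : Type*) [Fintype κ] :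
    Matrix κ κ (MvPolynomial (κ × κ) ℂ) :=
  Matrix.mvPolynomialX κ κ ℂ * (Matrix.mvPolynomialX κ κ ℂ)ᵀ -
    (Matrix.mvPolynomialX κ κ ℂ)ᵀ * Matrix.mvPolynomialX κ κ ℂ

theorem commutatorDerivation_apply (i j : κ) (P : MvPolynomial (κ × κ) ℂ) :
    commutatorDerivation i j P = ∑ p : κ × κ, (Matrix.single i j 1 * Matrix.mvPolynomialX κ κ ℂ -
      Matrix.mvPolynomialX κ κ ℂ * Matrix.single i j 1 : Matrix κ κ (MvPolynomial (κ × κ) ℂ))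
      p.1 p.2 * MvPolynomial.pderiv p P := by
  rw [commutatorDerivation, ← Derivation.coeFnAddMonoidHom_apply, map_sum, Finset.sum_apply]
  rfl

theorem map_commutatorDerivation (i j : κ) :
    (Matrix.mvPolynomialX κ κ ℂ).map (commutatorDerivation i j) =
      Matrix.single i j 1 * Matrix.mvPolynomialX κ κ ℂ -
        Matrix.mvPolynomialX κ κ ℂ * Matrix.single i j 1 := by
  ext1 k l
  rw [Matrix.map_apply, Matrix.mvPolynomialX_apply, commutatorDerivation_apply,
    Finset.sum_eq_single (k, l)]
  · simp
  · intro p _ hp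
    simp [MvPolynomial.pderiv_X_of_ne hp.symm]
  · simp

theorem span_prod_X_eq_top (ι : Type*) :
    Submodule.span ℂ (Set.range fun l : List ι => (l.map (MvPolynomial.X (R := ℂ))).prod) = ⊤ := by
  rw [eq_top_iff]
  rintro P -
  induction P using MvPolynomial.induction_on with
  | C a =>
    have : (MvPolynomial.C a : MvPolynomial ι ℂ) = a • 1 := by
      rw [MvPolynomial.smul_eq_C_mul, mul_one]
    rw [this]
    exact Submodule.smul_mem _ _ (Submodule.subset_span ⟨[], by simp⟩)
  | add p q hp hq => exact Submodule.add_mem _ hp hq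
  | mul_X p i hp =>
    induction hp using Submodule.span_induction with
    | mem x hx =>
      obtain ⟨l, rfl⟩ := hx
      exact Submodule.subset_span ⟨i :: l, by simp [mul_comm]⟩
    | zero => simp
    | add x y _ _ h1 h2 => rw [add_mul]; exact Submodule.add_mem _ h1 h2
    | smul r x _ h => rw [smul_mul_assoc]; exact Submodule.smul_mem _ _ h

theorem linearMap_eq_zero_of_orthogonal_invariant (ℓ : MvPolynomial (κ × κ) ℂ →ₗ[ℂ] ℂ)
    (hC : ∀ Q i j, ℓ (Q * genericCommutator κ i j) = 0)
    (hτ : ∀ Q, ℓ (transposeHom κ Q) = - ℓ Q) (hσ : ∀ j Q, ℓ (reflectionHom j Q) = ℓ Q)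
    (hδ : ∀ i j Q, ℓ (commutatorDerivation i j Q) = ℓ (commutatorDerivation j i Q)) : ℓ = 0 := by
  refine LinearMap.ext_on_range (span_prod_X_eq_top (κ × κ)) fun l => ?_
  have := eq_zero_mul_wordProd (P := Fin l.length) (X := Matrix.mvPolynomialX κ κ ℂ) ℓ
    (transposeHom κ) reflectionHom
    (fun i j => commutatorDerivation i j - commutatorDerivation j i) ?_ ?_ ?_ hC hτ hσ ?_
    _ Finset.univ rfl (fun _ => 1) (fun _ => 0) 1 (map_one _) (fun _ => map_one _)
    (fun _ _ => Derivation.map_one_eq_zero _)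
    (Sum.elim (fun p => l[p].1) (fun p => l[p].2))
  · rw [one_mul, wordProd] at this
    rw [LinearMap.zero_apply, ← this]
    congr 1
    simp only [transposeWord, pow_one, pow_zero, mul_one, Sum.elim_inl, Sum.elim_inr,
      Matrix.mvPolynomialX_apply, Prod.mk.eta]
    rw [← Fin.prod_univ_fun_getElem]
    rfl
  · ext1 i j
    simp [transposeHom]
  · intro j
    ext1 k l
    simp [reflectionHom]
  · intro i j
    have h1 := map_commutatorDerivation (κ := κ) i j
    have h2 := map_commutatorDerivation (κ := κ) j i
    have : (Matrix.mvPolynomialX κ κ ℂ).map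
        (commutatorDerivation i j - commutatorDerivation j i) =
        (Matrix.mvPolynomialX κ κ ℂ).map (commutatorDerivation i j) -
        (Matrix.mvPolynomialX κ κ ℂ).map (commutatorDerivation j i) := by
      ext1 k l
      simp
    rw [this, h1, h2, skewUnit]
    noncomm_ring
  · intro i j Q
    rw [Derivation.sub_apply, map_sub, hδ, sub_self]

omit [Fintype κ] [DecidableEq κ] in
theorem isHomogeneous_mvPolynomialX (k l : κ) :
    (Matrix.mvPolynomialX κ κ ℂ k l).IsHomogeneous 1 :=
  MvPolynomial.isHomogeneous_X _ _

theorem isHomogeneous_commutatorDerivation (i j : κ) {P : MvPolynomial (κ × κ) ℂ} {m : ℕ}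
    (hP : P.IsHomogeneous m) : (commutatorDerivation i j P).IsHomogeneous m := by
  rw [commutatorDerivation_apply]
  refine MvPolynomial.IsHomogeneous.sum _ _ _ fun p _ => ?_
  rcases m with _ | m
  · rw [← MvPolynomial.totalDegree_zero_iff_isHomogeneous,
      MvPolynomial.totalDegree_eq_zero_iff_eq_C]
      at hP
    rw [hP, MvPolynomial.pderiv_C, mul_zero]
    exact MvPolynomial.isHomogeneous_zero _ _ _
  have h1 : ((Matrix.single i j 1 * Matrix.mvPolynomialX κ κ ℂ -
      Matrix.mvPolynomialX κ κ ℂ * Matrix.single i j 1 : Matrix κ κ (MvPolynomial (κ × κ) ℂ))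
      p.1 p.2).IsHomogeneous 1 := by
    rw [Matrix.sub_apply, Matrix.mul_apply, Matrix.mul_apply]
    refine MvPolynomial.IsHomogeneous.sub ?_ ?_ <;>
      refine MvPolynomial.IsHomogeneous.sum _ _ _ fun k _ => ?_
    · rw [Matrix.single_apply]
      split_ifs
      · simpa using isHomogeneous_mvPolynomialX k p.2
      · simpa using MvPolynomial.isHomogeneous_zero _ _ _
    · rw [Matrix.single_apply]
      split_ifs
      · simpa using isHomogeneous_mvPolynomialX p.1 k
      · simpa using MvPolynomial.isHomogeneous_zero _ _ _
  rw [add_comm m 1]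
  exact h1.mul hP.pderiv

omit [Fintype κ] [DecidableEq κ] in
theorem isHomogeneous_transposeHom {P : MvPolynomial (κ × κ) ℂ} {m : ℕ}
    (hP : P.IsHomogeneous m) : (transposeHom κ P).IsHomogeneous m :=
  hP.rename_isHomogeneous

theorem isHomogeneous_reflectionHom (j : κ) {P : MvPolynomial (κ × κ) ℂ} {m : ℕ}
    (hP : P.IsHomogeneous m) : (reflectionHom j P).IsHomogeneous m := by
  have := hP.aeval (fun p : κ × κ => (reflectionMatrix _ j * Matrix.mvPolynomialX κ κ ℂ *
    reflectionMatrix _ j : Matrix κ κ (MvPolynomial (κ × κ) ℂ)) p.1 p.2) (n := 1) ?_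
  · rwa [mul_comm, mul_one] at this
  intro p
  rw [reflectionMatrix_conj_apply]
  have h1 := isHomogeneous_mvPolynomialX (κ := κ) p.1 p.2
  have h2 := h1.neg
  split_ifs <;> simpa only [neg_mul, one_mul, mul_neg, neg_neg, mul_one]

omit [DecidableEq κ] in
theorem isHomogeneous_genericCommutator (i j : κ) :
    (genericCommutator κ i j).IsHomogeneous 2 := by
  rw [genericCommutator, Matrix.sub_apply, Matrix.mul_apply, Matrix.mul_apply]
  exact MvPolynomial.IsHomogeneous.sub
    (MvPolynomial.IsHomogeneous.sum _ _ _ fun k _ =>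
      (isHomogeneous_mvPolynomialX _ _).mul (isHomogeneous_mvPolynomialX _ _))
    (MvPolynomial.IsHomogeneous.sum _ _ _ fun k _ =>
      (isHomogeneous_mvPolynomialX _ _).mul (isHomogeneous_mvPolynomialX _ _))

omit [DecidableEq κ] in
theorem genericCommutator_swap (i j : κ) : genericCommutator κ i j = genericCommutator κ j i := by
  have : (genericCommutator κ)ᵀ = genericCommutator κ := by
    simp [genericCommutator, Matrix.transpose_mul]
  rw [← congrFun (congrFun this j) i]; rfl

theorem linearMap_ext_isHomogeneous {ι : Type*} {f g : MvPolynomial ι ℂ →ₗ[ℂ] ℂ}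
    (h : ∀ (m : ℕ) (Q : MvPolynomial ι ℂ), Q.IsHomogeneous m → f Q = g Q) : f = g := by
  refine LinearMap.ext fun Q => ?_
  rw [← MvPolynomial.sum_homogeneousComponent Q, map_sum, map_sum]
  exact Finset.sum_congr rfl fun m _ =>
    h m _ (MvPolynomial.homogeneousComponent_isHomogeneous m Q)

theorem linearMap_eq_zero_of_gaussian_invariant (ℓ : MvPolynomial (κ × κ) ℂ →ₗ[ℂ] ℂ) {c : ℂ}
    (hc : c ≠ 0)
    (hδ : ∀ i j Q, ℓ (commutatorDerivation i j Q) = c * ℓ (Q * genericCommutator κ j i))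
    (hτ : ∀ Q, ℓ (transposeHom κ Q) = - ℓ Q) (hσ : ∀ j Q, ℓ (reflectionHom j Q) = ℓ Q) :
    ℓ = 0 := by
  refine linearMap_ext_isHomogeneous fun m => ?_
  induction m using Nat.strong_induction_on with
  | _ m ih =>
  have hcomp : ∀ {d : ℕ} {Q : MvPolynomial (κ × κ) ℂ}, Q.IsHomogeneous d →
      (ℓ ∘ₗ MvPolynomial.homogeneousComponent m) Q = if d = m then ℓ Q else 0 := by
    intro d Q hQ
    rw [LinearMap.comp_apply,
      MvPolynomial.homogeneousComponent_of_mem ((MvPolynomial.mem_homogeneousSubmodule _ _).2 hQ)]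
    simp only [eq_comm (a := m)]
    split_ifs with h1
    · rfl
    · exact map_zero ℓ
  have h0 := linearMap_eq_zero_of_orthogonal_invariant
    (ℓ ∘ₗ MvPolynomial.homogeneousComponent m) ?_ ?_ ?_ ?_
  · intro Q hQ
    have := hcomp hQ
    rw [h0, if_pos rfl] at this
    exact this.symm
  · intro Q i j
    refine LinearMap.congr_fun (f := (ℓ ∘ₗ MvPolynomial.homogeneousComponent m) ∘ₗ
      LinearMap.mulRight ℂ (genericCommutator κ i j)) (g := 0)
      (linearMap_ext_isHomogeneous fun d Q hQ => ?_) Q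
    rw [LinearMap.comp_apply, LinearMap.mulRight_apply,
      hcomp (hQ.mul (isHomogeneous_genericCommutator i j))]
    split_ifs with h
    · have h1 := hδ j i Q
      rw [ih d (by omega) _ (isHomogeneous_commutatorDerivation j i hQ), LinearMap.zero_apply,
        zero_eq_mul] at h1
      simpa using h1.resolve_left hc
    · rfl
  · intro Q
    refine LinearMap.congr_fun (f := (ℓ ∘ₗ MvPolynomial.homogeneousComponent m) ∘ₗ
      (transposeHom κ).toLinearMap) (g := - (ℓ ∘ₗ MvPolynomial.homogeneousComponent m))
      (linearMap_ext_isHomogeneous fun d Q hQ => ?_) Q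
    rw [LinearMap.comp_apply, AlgHom.toLinearMap_apply, hcomp (isHomogeneous_transposeHom hQ),
      LinearMap.neg_apply, hcomp hQ, hτ]
    split_ifs <;> simp
  · intro j Q
    refine LinearMap.congr_fun (f := (ℓ ∘ₗ MvPolynomial.homogeneousComponent m) ∘ₗ
      (reflectionHom j).toLinearMap) (g := (ℓ ∘ₗ MvPolynomial.homogeneousComponent m))
      (linearMap_ext_isHomogeneous fun d Q hQ => ?_) Q
    rw [LinearMap.comp_apply, AlgHom.toLinearMap_apply, hcomp (isHomogeneous_reflectionHom j hQ),
      hcomp hQ, hσ]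
  · intro i j Q
    refine LinearMap.congr_fun (f := (ℓ ∘ₗ MvPolynomial.homogeneousComponent m) ∘ₗ
      (commutatorDerivation i j : _ →ₗ[ℂ] _)) (g := (ℓ ∘ₗ MvPolynomial.homogeneousComponent m) ∘ₗ
      (commutatorDerivation j i : _ →ₗ[ℂ] _))
      (linearMap_ext_isHomogeneous fun d Q hQ => ?_) Q
    refine (hcomp (isHomogeneous_commutatorDerivation i j hQ)).trans
      (Eq.trans ?_ (hcomp (isHomogeneous_commutatorDerivation j i hQ)).symm)
    rw [hδ, hδ, genericCommutator_swap]

end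

section
variable {F W : Type*} [NormedAddCommGroup F] [NormedSpace ℝ F]
  [NormedAddCommGroup W] [NormedSpace ℝ W]

/-- The first order Taylor remainder of a translation of a Schwartz function. -/
noncomputable def translationRemainder (v : W) (Φ : 𝓢(W, F)) : 𝓢(W, F) :=
  compSubConstCLM ℝ (-v) Φ - Φ - ∂_{v} Φ

theorem translationRemainder_apply (v : W) (Φ : 𝓢(W, F)) (w : W) :
    translationRemainder v Φ w = Φ (w + v) - Φ w - fderiv ℝ Φ w v := by
  simp [translationRemainder, lineDerivOp_apply_eq_fderiv]

theorem fderiv_translationRemainder (v : W) (Φ : 𝓢(W, F)) :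
    fderivCLM ℝ W F (translationRemainder v Φ) =
      translationRemainder v (fderivCLM ℝ W F Φ) := by
  ext w h
  rw [translationRemainder_apply, fderivCLM_apply]
  have h1 : ⇑(translationRemainder v Φ) =
      fun w => Φ (w + v) - Φ w - fderivCLM ℝ W F Φ w v :=
    funext fun w => translationRemainder_apply v Φ w
  have h2 : HasFDerivAt (fun w => Φ (w + v)) (fderiv ℝ Φ (w + v)) w :=
    (hasFDerivAt_comp_add_right v).2 (Φ.hasFDerivAt (w + v))
  have h3 : HasFDerivAt (fun w => fderivCLM ℝ W F Φ w v)
      ((fderiv ℝ (fderivCLM ℝ W F Φ) w).flip v) w :=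
    by simpa using ((fderivCLM ℝ W F Φ).hasFDerivAt w).clm_apply (hasFDerivAt_const v w)
  rw [h1, ((h2.fun_sub (Φ.hasFDerivAt w)).fun_sub h3).fderiv]
  have hsymm : IsSymmSndFDerivAt ℝ Φ w :=
    ((Φ.smooth 2).contDiffAt (x := w)).isSymmSndFDerivAt (by simp)
  have := hsymm h v
  simp only [_root_.sub_apply, ContinuousLinearMap.flip_apply, fderivCLM_apply]
  congr 1

theorem norm_translationRemainder_le (Φ : 𝓢(W, F)) (k : ℕ) :
    ∃ C, ∀ v : W, ‖v‖ ≤ 1 → ∀ w, ‖w‖ ^ k * ‖translationRemainder v Φ w‖ ≤ C * ‖v‖ ^ 2 := by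
  set Ψ := fderivCLM ℝ W _ (fderivCLM ℝ W F Φ) with hΨ
  refine ⟨2 ^ k * (Finset.Iic (k, 0)).sup (fun m => SchwartzMap.seminorm ℝ m.1 m.2) Ψ,
    fun v hv w => ?_⟩
  set B := 2 ^ k * (Finset.Iic (k, 0)).sup (fun m => SchwartzMap.seminorm ℝ m.1 m.2) Ψ with hB
  have hΨB : ∀ y, (1 + ‖y‖) ^ k * ‖Ψ y‖ ≤ B := fun y => by
    simpa using one_add_le_sup_seminorm_apply (𝕜 := ℝ) (m := (k, 0)) (k := k) (n := 0)
      le_rfl le_rfl Ψ y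
  have hB0 : 0 ≤ B := (by positivity : 0 ≤ (1 + ‖(0 : W)‖) ^ k * ‖Ψ 0‖).trans (hΨB 0)
  rcases eq_or_lt_of_le (by positivity : 0 ≤ ‖w‖ ^ k) with h0 | h0
  · rw [← h0, zero_mul]; positivity
  rw [mul_comm, ← le_div_iff₀ h0]
  have hmem : w ∈ Metric.closedBall w ‖v‖ := Metric.mem_closedBall_self (norm_nonneg _)
  have hmem' : w + v ∈ Metric.closedBall w ‖v‖ := by simp
  have hΨw : ∀ y ∈ Metric.closedBall w ‖v‖, ‖Ψ y‖ ≤ B / ‖w‖ ^ k := by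
    intro y hy
    rw [le_div_iff₀ h0, mul_comm]
    refine le_trans ?_ (hΨB y)
    gcongr
    rw [mem_closedBall_iff_norm'] at hy
    calc ‖w‖ = ‖(w - y) + y‖ := by simp
      _ ≤ ‖w - y‖ + ‖y‖ := norm_add_le _ _
      _ ≤ 1 + ‖y‖ := by gcongr; exact hy.trans hv
  have h1 : ∀ y ∈ Metric.closedBall w ‖v‖,
      ‖fderiv ℝ Φ y - fderiv ℝ Φ w‖ ≤ B / ‖w‖ ^ k * ‖v‖ := by
    intro y hy
    refine ((convex_closedBall w ‖v‖).norm_image_sub_le_of_norm_hasFDerivWithin_le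
      (f := fderivCLM ℝ W F Φ) (f' := Ψ)
      (fun x _ => ((fderivCLM ℝ W F Φ).hasFDerivAt x).hasFDerivWithinAt) hΨw hmem hy).trans ?_
    gcongr
    rwa [mem_closedBall_iff_norm] at hy
  have h2 := (convex_closedBall w ‖v‖).norm_image_sub_le_of_norm_hasFDerivWithin_le
      (f := fun y => Φ y - fderiv ℝ Φ w y)
      (fun x _ => ((Φ.hasFDerivAt x).sub (fderiv ℝ Φ w).hasFDerivAt).hasFDerivWithinAt)
      h1 hmem hmem'
  rw [translationRemainder_apply]
  refine le_trans (le_of_eq ?_) (h2.trans (le_of_eq ?_))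
  · congr 1
    simp only [map_add]
    abel
  · simp only [add_sub_cancel_left]
    ring

end

/-- The first order Taylor remainder of translation is quadratic in all Schwartz seminorms. -/
theorem norm_iteratedFDeriv_translationRemainder_le {W : Type} [NormedAddCommGroup W]
    [NormedSpace ℝ W] (k m : ℕ) : ∀ {F : Type} [NormedAddCommGroup F] [NormedSpace ℝ F]
    (Φ : 𝓢(W, F)), ∃ C, ∀ v : W, ‖v‖ ≤ 1 → ∀ w,
      ‖w‖ ^ k * ‖iteratedFDeriv ℝ m (translationRemainder v Φ) w‖ ≤ C * ‖v‖ ^ 2 := by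
  induction m with
  | zero =>
    intro F _ _ Φ
    simpa using norm_translationRemainder_le Φ k
  | succ m ih =>
    intro F _ _ Φ
    obtain ⟨C, hC⟩ := ih (fderivCLM ℝ W F Φ)
    refine ⟨C, fun v hv w => ?_⟩
    rw [← norm_iteratedFDeriv_fderiv]
    have := hC v hv w
    rwa [← fderiv_translationRemainder] at this

section
variable {S E F : Type*} [NormedAddCommGroup S] [NormedSpace ℝ S]
  [NormedAddCommGroup E] [NormedSpace ℝ E] [NormedAddCommGroup F] [NormedSpace ℝ F]

/-- The restriction of a Schwartz function of two variables to a slice. -/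
noncomputable def sliceCLM (s : S) : 𝓢(S × E, F) →L[ℝ] 𝓢(E, F) :=
  compCLM ℝ (g := fun x => (s, x))
    (by
      have : (fun x : E => (s, x)) = fun x => (s, (0 : E)) + ContinuousLinearMap.inr ℝ S E x := by
        ext x <;> simp
      rw [this]
      exact (Function.HasTemperateGrowth.const _).add
        (ContinuousLinearMap.hasTemperateGrowth _))
    ⟨1, 1, fun x => by
      rw [pow_one, one_mul]
      have := norm_snd_le (s, x)
      linarith⟩

@[simp]
theorem sliceCLM_apply (s : S) (Φ : 𝓢(S × E, F)) (x : E) : sliceCLM s Φ x = Φ (s, x) := rfl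

theorem norm_iteratedFDeriv_sliceCLM_le (s : S) (Φ : 𝓢(S × E, F)) (m : ℕ) (x : E) :
    ‖iteratedFDeriv ℝ m (sliceCLM s Φ) x‖ ≤ ‖iteratedFDeriv ℝ m Φ (s, x)‖ := by
  have h1 : ⇑(sliceCLM s Φ) =
      (fun w => Φ ((s, 0) + w)) ∘ ContinuousLinearMap.inr ℝ S E := by
    ext x
    simp
  have h2 : ContDiff ℝ m fun w => Φ ((s, 0) + w) := by
    have := Φ.smooth m
    fun_prop
  rw [h1, ContinuousLinearMap.iteratedFDeriv_comp_right _ h2 x le_rfl,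
    iteratedFDeriv_comp_add_left]
  refine (ContinuousMultilinearMap.norm_compContinuousLinearMap_le _ _).trans ?_
  have h3 : (s, (0 : E)) + ContinuousLinearMap.inr ℝ S E x = (s, x) := by simp
  rw [h3]
  refine mul_le_of_le_one_right (norm_nonneg _) (Finset.prod_le_one (fun _ _ => norm_nonneg _)
    fun _ _ => ContinuousLinearMap.norm_inr_le_one ℝ S E)

/-- A continuous linear map on Schwartz space with values in a normed space is bounded along a
family of functions whose seminorms are bounded. -/
theorem exists_norm_le_of_seminorm_le {G : Type*} [NormedAddCommGroup G] [NormedSpace ℝ G]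
    (T : 𝓢(E, F) →L[ℝ] G) {α : Type*} (p : α → Prop) (φ : α → 𝓢(E, F)) (b : α → ℝ)
    (hb : ∀ a, p a → 0 ≤ b a)
    (h : ∀ k m, ∃ C, ∀ a, p a → ∀ x, ‖x‖ ^ k * ‖iteratedFDeriv ℝ m (φ a) x‖ ≤ C * b a) :
    ∃ C, ∀ a, p a → ‖T (φ a)‖ ≤ C * b a := by
  obtain ⟨s, C, _, hC⟩ := Seminorm.bound_of_continuous (schwartz_withSeminorms ℝ E F)
    ((normSeminorm ℝ G).comp T.toLinearMap) (by exact T.continuous.norm)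
  choose K hK using h
  refine ⟨C * ∑ i ∈ s, |K i.1 i.2|, fun a ha => ?_⟩
  refine (hC (φ a)).trans ?_
  rw [_root_.smul_apply, NNReal.smul_def, smul_eq_mul, mul_assoc]
  gcongr
  rw [Finset.sum_mul]
  refine Seminorm.finset_sup_apply_le (Finset.sum_nonneg fun i _ => mul_nonneg (abs_nonneg _)
    (hb a ha)) fun i hi => ?_
  refine le_trans ?_ (Finset.single_le_sum (f := fun i => |K i.1 i.2| * b a)
    (fun i _ => mul_nonneg (abs_nonneg _) (hb a ha)) hi)
  refine seminorm_le_bound ℝ i.1 i.2 _ (mul_nonneg (abs_nonneg _) (hb a ha)) fun x => ?_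
  exact (hK i.1 i.2 a ha x).trans (mul_le_mul_of_nonneg_right (le_abs_self _) (hb a ha))

end

/-- Evaluating a continuous linear map along the slices of a Schwartz function is
differentiable. -/
theorem exists_hasFDerivAt_sliceCLM {S E F : Type} [NormedAddCommGroup S] [NormedSpace ℝ S]
    [FiniteDimensional ℝ S] [NormedAddCommGroup E] [NormedSpace ℝ E] [NormedAddCommGroup F]
    [NormedSpace ℝ F] {G : Type*} [NormedAddCommGroup G] [NormedSpace ℝ G]
    (T : 𝓢(E, F) →L[ℝ] G) (Φ : 𝓢(S × E, F)) (s : S) :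
    ∃ L : S →L[ℝ] G, (∀ v, L v = T (sliceCLM s (∂_{((v, 0) : S × E)} Φ))) ∧
      HasFDerivAt (fun s => T (sliceCLM s Φ)) L s := by
  let L₀ : S →ₗ[ℝ] G :=
    { toFun := fun v => T (sliceCLM s (∂_{((v, 0) : S × E)} Φ))
      map_add' := fun v w => by
        rw [← map_add, ← map_add]
        congr 2
        ext x
        simp [lineDerivOp_apply_eq_fderiv, ← map_add]
      map_smul' := fun c v => by
        rw [RingHom.id_apply, ← map_smul, ← map_smul]
        congr 2
        ext x
        simp [lineDerivOp_apply_eq_fderiv, ← map_smul] }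
  refine ⟨LinearMap.toContinuousLinearMap L₀, fun v => rfl, ?_⟩
  obtain ⟨C, hC⟩ := exists_norm_le_of_seminorm_le T (fun v : S => ‖v‖ ≤ 1)
    (fun v => sliceCLM s (translationRemainder (v, 0) Φ)) (fun v => ‖v‖ ^ 2)
    (fun _ _ => by positivity) (fun k m => by
      obtain ⟨C, hC⟩ := norm_iteratedFDeriv_translationRemainder_le k m Φ
      refine ⟨C, fun v hv x => ?_⟩
      have := hC (v, 0) (by simpa using hv) (s, x)
      rw [show ‖((v, 0) : S × E)‖ = ‖v‖ by simp] at this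
      refine le_trans ?_ this
      gcongr
      · exact norm_snd_le (s, x)
      · exact norm_iteratedFDeriv_sliceCLM_le s _ m x)
  rw [hasFDerivAt_iff_isLittleO_nhds_zero]
  have hO : (fun v : S => T (sliceCLM (s + v) Φ) - T (sliceCLM s Φ) - L₀ v) =O[nhds 0]
      fun v => ‖v‖ ^ 2 := by
    refine Asymptotics.IsBigO.of_bound C ?_
    filter_upwards [Metric.closedBall_mem_nhds (0 : S) one_pos] with v hv
    rw [mem_closedBall_zero_iff] at hv
    have := hC v hv
    rw [Real.norm_of_nonneg (by positivity)]
    convert this using 2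
    simp only [L₀, LinearMap.coe_mk, AddHom.coe_mk, ← map_sub]
    congr 1
    ext x
    simp [translationRemainder_apply, lineDerivOp_apply_eq_fderiv]
  refine hO.trans_isLittleO ?_
  have := Asymptotics.isLittleO_norm_pow_id (E' := S) (n := 2) (by norm_num)
  exact this

theorem continuous_apply_sliceCLM {S E F : Type} [NormedAddCommGroup S] [NormedSpace ℝ S]
    [FiniteDimensional ℝ S] [NormedAddCommGroup E] [NormedSpace ℝ E] [NormedAddCommGroup F]
    [NormedSpace ℝ F] {G : Type*} [NormedAddCommGroup G] [NormedSpace ℝ G]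
    (T : 𝓢(E, F) →L[ℝ] G) (Φ : 𝓢(S × E, F)) : Continuous fun s => T (sliceCLM s Φ) := by
  rw [continuous_iff_continuousAt]
  intro s
  obtain ⟨L, -, hL⟩ := exists_hasFDerivAt_sliceCLM T Φ s
  exact hL.continuousAt

theorem exists_schwartzMap_eq_exp_neg_of_nonneg :
    ∃ f : 𝓢(ℝ, ℂ), ∀ t, 0 ≤ t → f t = (Real.exp (-t) : ℝ) := by
  have hsm : ContDiff ℝ (⊤ : ℕ∞) fun t : ℝ => Real.smoothTransition (t + 1) * Real.exp (-t) :=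
    (Real.smoothTransition.contDiff.comp (contDiff_id.add contDiff_const)).mul
      (Real.contDiff_exp.comp contDiff_neg)
  let g : 𝓢(ℝ, ℝ) :=
    { toFun := fun t => Real.smoothTransition (t + 1) * Real.exp (-t)
      smooth' := hsm
      decay' := fun k n => by
        have hc : Continuous fun x : ℝ => ‖x‖ ^ k * ‖iteratedFDeriv ℝ n
            (fun t : ℝ => Real.smoothTransition (t + 1) * Real.exp (-t)) x‖ :=
          (continuous_norm.pow k).mul (hsm.continuous_iteratedFDeriv (mod_cast le_top)).norm
        obtain ⟨C, hC⟩ := (isCompact_Icc (a := (-2 : ℝ)) (b := 1)).exists_bound_of_continuousOn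
          hc.continuousOn
        refine ⟨max C k.factorial, fun x => ?_⟩
        rcases lt_or_ge x (-1) with hx | hx
        · have : (fun t : ℝ => Real.smoothTransition (t + 1) * Real.exp (-t)) =ᶠ[nhds x]
              fun _ => 0 := by
            filter_upwards [Iio_mem_nhds hx] with t ht
            rw [Real.smoothTransition.zero_of_nonpos (by linarith [Set.mem_Iio.1 ht]), zero_mul]
          rw [(this.iteratedFDeriv ℝ n).eq_of_nhds]
          simp only [iteratedFDeriv_fun_zero, Pi.zero_apply, norm_zero, mul_zero]
          exact le_max_of_le_right (by positivity)
        rcases le_or_gt x 1 with hx1 | hx1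
        · exact le_max_of_le_left ((le_abs_self _).trans (hC x ⟨by linarith, hx1⟩))
        · have : (fun t : ℝ => Real.smoothTransition (t + 1) * Real.exp (-t)) =ᶠ[nhds x]
              fun t => Real.exp (-t) := by
            filter_upwards [Ioi_mem_nhds hx1] with t ht
            rw [Real.smoothTransition.one_of_one_le (by linarith [Set.mem_Ioi.1 ht]), one_mul]
          rw [(this.iteratedFDeriv ℝ n).eq_of_nhds, norm_iteratedFDeriv_eq_norm_iteratedDeriv,
            iteratedDeriv_comp_neg n Real.exp x, iteratedDeriv_eq_iterate, Real.iter_deriv_exp]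
          have h0 : 0 < x := by linarith
          simp only [norm_smul, norm_pow, norm_neg, norm_one, one_pow, one_mul,
            Real.norm_of_nonneg h0.le, Real.norm_eq_abs, Real.abs_exp]
          refine le_max_of_le_right ?_
          have := Real.pow_div_factorial_le_exp x h0.le k
          rw [div_le_iff₀ (by positivity)] at this
          calc x ^ k * Real.exp (-x) ≤ Real.exp x * k.factorial * Real.exp (-x) := by gcongr
            _ = k.factorial * (Real.exp x * Real.exp (-x)) := by ring
            _ = k.factorial := by rw [← Real.exp_add]; simp }
  refine ⟨postcompCLM Complex.ofRealCLM g, fun t ht => ?_⟩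
  change ((Real.smoothTransition (t + 1) * Real.exp (-t) : ℝ) : ℂ) = _
  rw [Real.smoothTransition.one_of_one_le (by linarith), one_mul]

section
variable {E : Type*} [NormedAddCommGroup E] [NormedSpace ℝ E]

theorem Function.HasTemperateGrowth.exp_neg {q : E → ℝ} (hq : q.HasTemperateGrowth)
    (h0 : ∀ x, 0 ≤ q x) :
    (fun x => ((Real.exp (-q x) : ℝ) : ℂ)).HasTemperateGrowth := by
  obtain ⟨f, hf⟩ := exists_schwartzMap_eq_exp_neg_of_nonneg
  have := f.hasTemperateGrowth.comp hq
  convert this using 2 with x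
  exact (hf _ (h0 x)).symm

theorem exists_schwartzMap_eq_exp_neg {q : E → ℝ} (hq : q.HasTemperateGrowth)
    (h0 : ∀ x, 0 ≤ q x) (hup : ∃ (k : ℕ) (C : ℝ), ∀ x, ‖x‖ ≤ C * (1 + ‖q x‖) ^ k) :
    ∃ f : 𝓢(E, ℂ), ∀ x, f x = (Real.exp (-q x) : ℝ) := by
  obtain ⟨f, hf⟩ := exists_schwartzMap_eq_exp_neg_of_nonneg
  exact ⟨compCLM ℝ hq hup f, fun x => hf _ (h0 x)⟩

theorem Function.HasTemperateGrowth.cexp_mul_I {q : E → ℝ} (hq : q.HasTemperateGrowth) :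
    (fun x => Complex.exp (q x * Complex.I)).HasTemperateGrowth := by
  have h : (fun t : ℝ => Complex.exp (t * Complex.I)).HasTemperateGrowth := by
    have hd : ∀ n, iteratedDeriv n (fun t : ℝ => Complex.exp (t * Complex.I)) =
        fun t : ℝ => Complex.I ^ n * Complex.exp (t * Complex.I) := by
      intro n
      induction n with
      | zero => simp
      | succ n ih =>
        rw [iteratedDeriv_succ, ih]
        funext t
        have : HasDerivAt (fun t : ℝ => Complex.I ^ n * Complex.exp (t * Complex.I))
            (Complex.I ^ n * (Complex.exp (t * Complex.I) * (1 * Complex.I))) t :=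
          (((Complex.ofRealCLM.hasDerivAt (x := t)).mul_const Complex.I).cexp).const_mul _
        rw [this.deriv]
        ring
    refine ⟨by
      have : ContDiff ℝ (⊤ : ℕ∞) fun t : ℝ => (t : ℂ) := Complex.ofRealCLM.contDiff
      fun_prop, fun n => ⟨0, 1, fun t => ?_⟩⟩
    rw [norm_iteratedFDeriv_eq_norm_iteratedDeriv, hd]
    simp [Complex.norm_exp_ofReal_mul_I]
  exact h.comp hq

end

theorem exists_schwartzMap_eq_exp_neg_of_norm_sq_le {E : Type*} [NormedAddCommGroup E]
    [NormedSpace ℝ E] {q : E → ℝ} (hq : q.HasTemperateGrowth) {c : ℝ} (hc : 0 < c)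
    (h : ∀ x, c * ‖x‖ ^ 2 ≤ q x) :
    ∃ f : 𝓢(E, ℂ), ∀ x, f x = (Real.exp (-q x) : ℝ) := by
  have h0 (x : E) : 0 ≤ q x := le_trans (by positivity) (h x)
  refine exists_schwartzMap_eq_exp_neg hq h0 ⟨1, 1 + c⁻¹, fun x => ?_⟩
  rw [Real.norm_of_nonneg (h0 x), pow_one]
  calc ‖x‖ ≤ (1 + c⁻¹) * (1 + c * ‖x‖ ^ 2) := by
        have h1 : 0 ≤ c⁻¹ + c * ‖x‖ ^ 2 := by positivity
        have h2 : (1 + c⁻¹) * (1 + c * ‖x‖ ^ 2) =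
            1 + ‖x‖ ^ 2 + (c⁻¹ + c * ‖x‖ ^ 2) := by
          field_simp; ring
        nlinarith [sq_nonneg (‖x‖ - 1)]
    _ ≤ _ := by gcongr; exact h x

section
variable {S E : Type*} [NormedAddCommGroup S] [NormedSpace ℝ S]
  [NormedAddCommGroup E] [NormedSpace ℝ E]

theorem norm_iteratedFDeriv_comp_fst_le {F : Type*} [NormedAddCommGroup F] [NormedSpace ℝ F]
    {f : S → F} (hf : ContDiff ℝ (⊤ : ℕ∞) f) (m : ℕ) (x : S × E) :
    ‖iteratedFDeriv ℝ m (fun x : S × E => f x.1) x‖ ≤ ‖iteratedFDeriv ℝ m f x.1‖ := by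
  have h1 : (fun x : S × E => f x.1) = f ∘ ContinuousLinearMap.fst ℝ S E := rfl
  rw [h1, ContinuousLinearMap.iteratedFDeriv_comp_right _ hf x (mod_cast le_top)]
  refine (ContinuousMultilinearMap.norm_compContinuousLinearMap_le _ _).trans ?_
  exact mul_le_of_le_one_right (norm_nonneg _) (Finset.prod_le_one (fun _ _ => norm_nonneg _)
    fun _ _ => ContinuousLinearMap.norm_fst_le ℝ S E)

theorem norm_iteratedFDeriv_comp_snd_le {F : Type*} [NormedAddCommGroup F] [NormedSpace ℝ F]
    {f : E → F} (hf : ContDiff ℝ (⊤ : ℕ∞) f) (m : ℕ) (x : S × E) :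
    ‖iteratedFDeriv ℝ m (fun x : S × E => f x.2) x‖ ≤ ‖iteratedFDeriv ℝ m f x.2‖ := by
  have h1 : (fun x : S × E => f x.2) = f ∘ ContinuousLinearMap.snd ℝ S E := rfl
  rw [h1, ContinuousLinearMap.iteratedFDeriv_comp_right _ hf x (mod_cast le_top)]
  refine (ContinuousMultilinearMap.norm_compContinuousLinearMap_le _ _).trans ?_
  exact mul_le_of_le_one_right (norm_nonneg _) (Finset.prod_le_one (fun _ _ => norm_nonneg _)
    fun _ _ => ContinuousLinearMap.norm_snd_le ℝ S E)

/-- The exterior product of two Schwartz functions. -/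
noncomputable def exteriorProduct (f : 𝓢(S, ℂ)) (φ : 𝓢(E, ℂ)) : 𝓢(S × E, ℂ) where
  toFun x := f x.1 * φ x.2
  smooth' := by
    have h1 := f.smooth'
    have h2 := φ.smooth'
    exact (h1.comp contDiff_fst).mul (h2.comp contDiff_snd)
  decay' k n := by
    choose C hC using f.decay'
    choose D hD using φ.decay'
    refine ⟨∑ i ∈ Finset.range (n + 1), n.choose i * (C k i * D 0 (n - i) + C 0 i * D k (n - i)),
      fun x => ?_⟩
    have h1 := f.smooth'
    have h2 := φ.smooth'
    have hL := norm_iteratedFDeriv_mul_le (h1.comp (contDiff_fst (E := S) (F := E)))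
      (h2.comp (contDiff_snd (E := S) (F := E))) x (n := n) (mod_cast le_top)
    refine (mul_le_mul_of_nonneg_left hL (by positivity)).trans ?_
    rw [Finset.mul_sum]
    refine Finset.sum_le_sum fun i _ => ?_
    have hf := norm_iteratedFDeriv_comp_fst_le h1 i x
    have hg := norm_iteratedFDeriv_comp_snd_le h2 (n - i) x
    set a := ‖iteratedFDeriv ℝ i f.toFun x.1‖ with ha
    set b := ‖iteratedFDeriv ℝ (n - i) φ.toFun x.2‖ with hb
    have ha0 : 0 ≤ a := norm_nonneg _
    have hb0 : 0 ≤ b := norm_nonneg _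
    have hk : ‖x‖ ^ k ≤ ‖x.1‖ ^ k + ‖x.2‖ ^ k := by
      rw [Prod.norm_def]
      rcases max_choice ‖x.1‖ ‖x.2‖ with h | h <;> rw [h] <;> simp
    have e1 : ‖x.1‖ ^ k * a ≤ C k i := hC k i x.1
    have e2 : a ≤ C 0 i := by simpa using hC 0 i x.1
    have e3 : ‖x.2‖ ^ k * b ≤ D k (n - i) := hD k (n - i) x.2
    have e4 : b ≤ D 0 (n - i) := by simpa using hD 0 (n - i) x.2
    calc _ ≤ (‖x.1‖ ^ k + ‖x.2‖ ^ k) * (n.choose i * a * b) := by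
          gcongr
          · exact hf
          · exact hg
      _ = n.choose i * ((‖x.1‖ ^ k * a) * b + a * (‖x.2‖ ^ k * b)) := by ring
      _ ≤ _ := by
          have := e2.trans' ha0
          have := e1.trans' (by positivity)
          gcongr

@[simp]
theorem exteriorProduct_apply (f : 𝓢(S, ℂ)) (φ : 𝓢(E, ℂ)) (x : S × E) :
    exteriorProduct f φ x = f x.1 * φ x.2 := rfl

end

/-- The weighted derivative `x ↦ ‖x‖ ^ k • D ^ m φ x` of a Schwartz function, as a bounded
continuous function. -/
noncomputable def weightedDerivCLM {E F : Type*} [NormedAddCommGroup E] [NormedSpace ℝ E]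
    [NormedAddCommGroup F] [NormedSpace ℝ F] (k m : ℕ) :
    𝓢(E, F) →L[ℝ] BoundedContinuousFunction E (E [×m]→L[ℝ] F) :=
  mkCLMtoNormedSpace (σ := RingHom.id ℝ) (G := BoundedContinuousFunction E (E [×m]→L[ℝ] F))
    (fun φ : 𝓢(E, F) => BoundedContinuousFunction.ofNormedAddCommGroup
      (fun x => ‖x‖ ^ k • iteratedFDeriv ℝ m φ x)
      ((continuous_norm.pow k).smul
        ((φ.smooth m).continuous_iteratedFDeriv le_rfl))
      (SchwartzMap.seminorm ℝ k m φ) (fun x => by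
        rw [norm_smul, norm_pow, norm_norm]
        exact le_seminorm ℝ k m φ x))
    (fun f g => by
      apply BoundedContinuousFunction.ext
      intro x
      change ‖x‖ ^ k • iteratedFDeriv ℝ m (f + g : E → F) x =
        ‖x‖ ^ k • iteratedFDeriv ℝ m f x + ‖x‖ ^ k • iteratedFDeriv ℝ m g x
      rw [iteratedFDeriv_add (f.smooth m) (g.smooth m), Pi.add_apply, smul_add])
    (fun a f => by
      apply BoundedContinuousFunction.ext
      intro x
      change ‖x‖ ^ k • iteratedFDeriv ℝ m (a • f : E → F) x =
        a • ‖x‖ ^ k • iteratedFDeriv ℝ m f x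
      rw [iteratedFDeriv_const_smul_apply ((f.smooth m).contDiffAt), smul_comm])
    ⟨{(k, m)}, 1, zero_le_one, fun f => by
      rw [one_mul, Finset.sup_singleton]
      exact BoundedContinuousFunction.norm_ofNormedAddCommGroup_le _ (apply_nonneg _ _) _⟩

theorem weightedDerivCLM_apply {E F : Type*} [NormedAddCommGroup E] [NormedSpace ℝ E]
    [NormedAddCommGroup F] [NormedSpace ℝ F] (k m : ℕ) (φ : 𝓢(E, F)) (x : E) :
    weightedDerivCLM k m φ x = ‖x‖ ^ k • iteratedFDeriv ℝ m φ x := rfl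

theorem seminorm_le_norm_weightedDerivCLM {E F : Type*} [NormedAddCommGroup E] [NormedSpace ℝ E]
    [NormedAddCommGroup F] [NormedSpace ℝ F] (k m : ℕ) (φ : 𝓢(E, F)) :
    SchwartzMap.seminorm ℝ k m φ ≤ ‖weightedDerivCLM k m φ‖ := by
  refine seminorm_le_bound ℝ k m φ (norm_nonneg (weightedDerivCLM k m φ)) fun x => ?_
  have := (weightedDerivCLM k m φ).norm_coe_le_norm x
  rwa [weightedDerivCLM_apply, norm_smul, norm_pow, norm_norm] at this

section
variable {S E F : Type*} [NormedAddCommGroup S] [NormedSpace ℝ S]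
  [NormedAddCommGroup E] [NormedSpace ℝ E] [NormedAddCommGroup F] [NormedSpace ℝ F]

theorem exists_norm_iteratedFDeriv_slice_le (Φ : 𝓢(S × E, F)) (k m N : ℕ) :
    ∃ C, 0 ≤ C ∧ ∀ s x, ‖x‖ ^ k * ‖iteratedFDeriv ℝ m (sliceCLM s Φ) x‖ ≤
      C * (1 + ‖s‖) ^ (-(N : ℝ)) := by
  refine ⟨2 ^ (k + N) * ((Finset.Iic (k + N, m)).sup
    fun i => SchwartzMap.seminorm ℝ i.1 i.2) Φ, by positivity, fun s x => ?_⟩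
  have h := one_add_le_sup_seminorm_apply (𝕜 := ℝ) (m := (k + N, m)) le_rfl le_rfl Φ (s, x)
  rw [Real.rpow_neg (by positivity), Real.rpow_natCast, ← div_eq_mul_inv,
    le_div_iff₀ (by positivity)]
  refine le_trans ?_ h
  have h1 : ‖x‖ ≤ 1 + ‖(s, x)‖ := (norm_snd_le (s, x)).trans (by linarith)
  have h2 : ‖s‖ ≤ ‖(s, x)‖ := norm_fst_le (s, x)
  calc _ ≤ (1 + ‖(s, x)‖) ^ k * ‖iteratedFDeriv ℝ m Φ (s, x)‖ * (1 + ‖(s, x)‖) ^ N := by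
        gcongr
        exact norm_iteratedFDeriv_sliceCLM_le s Φ m x
    _ = _ := by rw [pow_add]; ring

/-- The partial derivative of a Schwartz function in the second variable. -/
noncomputable def fderivSnd (Φ : 𝓢(S × E, F)) : 𝓢(S × E, E →L[ℝ] F) :=
  postcompCLM ((ContinuousLinearMap.compL ℝ E (S × E) F).flip (ContinuousLinearMap.inr ℝ S E))
    (fderivCLM ℝ (S × E) F Φ)

theorem fderiv_sliceCLM (Φ : 𝓢(S × E, F)) (s : S) (x : E) :
    fderiv ℝ (sliceCLM s Φ) x = sliceCLM s (fderivSnd Φ) x := by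
  have h : HasFDerivAt (fun x : E => (s, x)) (ContinuousLinearMap.inr ℝ S E) x :=
    hasFDerivAt_prodMk_right s x
  exact ((Φ.hasFDerivAt (s, x)).comp x h).fderiv

end

theorem integrable_apply_sliceCLM {S E F : Type} [NormedAddCommGroup S] [NormedSpace ℝ S]
    [FiniteDimensional ℝ S] [MeasurableSpace S] [BorelSpace S] (μ : Measure S)
    [μ.HasTemperateGrowth] [NormedAddCommGroup E] [NormedSpace ℝ E] [NormedAddCommGroup F]
    [NormedSpace ℝ F] {G : Type*} [NormedAddCommGroup G] [NormedSpace ℝ G]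
    (T : 𝓢(E, F) →L[ℝ] G) (Φ : 𝓢(S × E, F)) :
    Integrable (fun s => T (sliceCLM s Φ)) μ := by
  obtain ⟨C, hC⟩ := exists_norm_le_of_seminorm_le T (fun _ : S => True)
    (fun s => sliceCLM s Φ) (fun s => (1 + ‖s‖) ^ (-(μ.integrablePower : ℝ)))
    (fun _ _ => by positivity) fun k m =>
      let ⟨C, _, hC⟩ := exists_norm_iteratedFDeriv_slice_le Φ k m μ.integrablePower
      ⟨C, fun s _ x => hC s x⟩
  exact (μ.integrable_pow_neg_integrablePower.const_mul C).mono'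
    (continuous_apply_sliceCLM T Φ).aestronglyMeasurable (.of_forall fun s => hC s trivial)

/-- Evaluation of a Schwartz function at a point. -/
noncomputable def evalPointCLM {E F : Type*} [NormedAddCommGroup E] [NormedSpace ℝ E]
    [NormedAddCommGroup F] [NormedSpace ℝ F] (x : E) : 𝓢(E, F) →L[ℝ] F :=
  (BoundedContinuousFunction.evalCLM ℝ x).comp (toBoundedContinuousFunctionCLM ℝ E F)

theorem fderiv_eq_integral_fderivSnd {S E F : Type} [NormedAddCommGroup S] [NormedSpace ℝ S]
    [FiniteDimensional ℝ S] [MeasurableSpace S] [BorelSpace S] (μ : Measure S)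
    [μ.HasTemperateGrowth] [NormedAddCommGroup E] [NormedSpace ℝ E] [NormedAddCommGroup F]
    [NormedSpace ℝ F] (Φ : 𝓢(S × E, F)) (Ψ : 𝓢(E, F)) (h : ∀ x, Ψ x = ∫ s, Φ (s, x) ∂μ) (x : E) :
    fderiv ℝ Ψ x = ∫ s, fderivSnd Φ (s, x) ∂μ := by
  obtain ⟨C, hC0, hC⟩ := exists_norm_iteratedFDeriv_slice_le (fderivSnd Φ) 0 0 μ.integrablePower
  have hint (x : E) : Integrable (fun s => Φ (s, x)) μ :=
    integrable_apply_sliceCLM μ (evalPointCLM x) Φ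
  have hint' (x : E) : Integrable (fun s => fderivSnd Φ (s, x)) μ :=
    integrable_apply_sliceCLM μ (evalPointCLM x) (fderivSnd Φ)
  have key := hasFDerivAt_integral_of_dominated_of_fderiv_le (𝕜 := ℝ) (μ := μ) (x₀ := x)
    (F := fun x s => Φ (s, x)) (F' := fun x s => fderivSnd Φ (s, x)) Filter.univ_mem
    (.of_forall fun x => (hint x).aestronglyMeasurable) (hint x) (hint' x).aestronglyMeasurable
    (.of_forall fun s x _ => by simpa using hC s x)
    (μ.integrable_pow_neg_integrablePower.const_mul C)
    (.of_forall fun s x _ => by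
      have := (sliceCLM s Φ).hasFDerivAt x
      rw [fderiv_sliceCLM] at this
      exact this)
  rw [← key.fderiv]
  congr 1
  exact funext h

theorem iteratedFDeriv_eq_integral_sliceCLM {S E : Type} [NormedAddCommGroup S] [NormedSpace ℝ S]
    [FiniteDimensional ℝ S] [MeasurableSpace S] [BorelSpace S] (μ : Measure S)
    [μ.HasTemperateGrowth] [NormedAddCommGroup E] [NormedSpace ℝ E] (m : ℕ) :
    ∀ {F : Type} [NormedAddCommGroup F] [NormedSpace ℝ F] (Φ : 𝓢(S × E, F)) (Ψ : 𝓢(E, F)),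
    (∀ x, Ψ x = ∫ s, Φ (s, x) ∂μ) → ∀ x,
    iteratedFDeriv ℝ m Ψ x = ∫ s, iteratedFDeriv ℝ m (sliceCLM s Φ) x ∂μ := by
  induction m with
  | zero =>
    intro F _ _ Φ Ψ h x
    simp only [iteratedFDeriv_zero_eq_comp, Function.comp_apply, h, sliceCLM_apply]
    exact ((continuousMultilinearCurryFin0 ℝ E F).symm.toContinuousLinearEquiv.integral_comp_comm
      _).symm
  | succ m ih =>
    intro F _ _ Φ Ψ h x
    simp only [iteratedFDeriv_succ_eq_comp_right, Function.comp_apply, fderiv_sliceCLM]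
    have := ih (fderivSnd Φ) (fderivCLM ℝ E F Ψ) (fun x => by
      rw [fderivCLM_apply]
      exact fderiv_eq_integral_fderivSnd μ Φ Ψ h x) x
    have e := ContinuousLinearEquiv.integral_comp_comm (μ := μ)
      (continuousMultilinearCurryRightEquiv' ℝ m E F).symm.toContinuousLinearEquiv
      (fun s => iteratedFDeriv ℝ m (sliceCLM s (fderivSnd Φ)) x)
    rw [← this] at e
    exact e.symm

/-- If `‖T φ‖ ≤ C * ‖J φ‖` and `J Ψ` is the integral of vectors `J (φ s)` with `T (φ s) = 0`, then
`T Ψ = 0`. -/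
theorem map_eq_zero_of_integral_eq {X S B G : Type*} [AddCommGroup X] [Module ℝ X]
    [MeasurableSpace S] {μ : Measure S} [NormedAddCommGroup B] [NormedSpace ℝ B] [CompleteSpace B]
    [NormedAddCommGroup G] [NormedSpace ℝ G] (J : X →ₗ[ℝ] B) (T : X →ₗ[ℝ] G) {C : ℝ} (hC : 0 ≤ C)
    (hJ : ∀ φ, ‖T φ‖ ≤ C * ‖J φ‖) {φ : S → X} {Ψ : X} (hint : Integrable (fun s => J (φ s)) μ)
    (hJΨ : J Ψ = ∫ s, J (φ s) ∂μ) (hT : ∀ s, T (φ s) = 0) : T Ψ = 0 := by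
  let p := (T.ker.map J).topologicalClosure
  have hcl : IsClosed (p : Set B) := Submodule.isClosed_topologicalClosure _
  have hmem : J Ψ ∈ p := by
    rw [← Submodule.Quotient.mk_eq_zero, hJΨ]
    have h1 := (p.mkQL).integral_comp_comm hint
    refine Eq.trans h1.symm ?_
    rw [← integral_zero S _ (μ := μ)]
    congr 1 with s
    exact (Submodule.Quotient.mk_eq_zero p).2
      (Submodule.le_topologicalClosure _ ⟨_, hT s, rfl⟩)
  rw [← norm_le_zero_iff]
  refine le_of_forall_pos_le_add fun ε hε => ?_
  obtain ⟨_, ⟨χ, hχ, rfl⟩, hd⟩ := Metric.mem_closure_iff.1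
    (show J Ψ ∈ closure (T.ker.map J : Set B) from hmem) (ε / (C + 1)) (by positivity)
  have h2 : T Ψ = T (Ψ - χ) := by rw [map_sub, show T χ = 0 from hχ, sub_zero]
  rw [h2, zero_add]
  refine (hJ _).trans ?_
  rw [map_sub]
  rw [dist_eq_norm] at hd
  calc C * ‖J Ψ - J χ‖ ≤ (C + 1) * (ε / (C + 1)) := by
        gcongr
        linarith
    _ = ε := by field_simp

/-- A tempered distribution killing all slices of a Schwartz function kills its partial
integral. -/
theorem map_eq_zero_of_sliceCLM {S E F : Type} [NormedAddCommGroup S] [NormedSpace ℝ S]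
    [FiniteDimensional ℝ S] [MeasurableSpace S] [BorelSpace S] (μ : Measure S)
    [μ.HasTemperateGrowth] [NormedAddCommGroup E] [NormedSpace ℝ E] [NormedAddCommGroup F]
    [NormedSpace ℝ F] [CompleteSpace F] {G : Type*} [NormedAddCommGroup G] [NormedSpace ℝ G]
    (T : 𝓢(E, F) →L[ℝ] G) (Φ : 𝓢(S × E, F)) (Ψ : 𝓢(E, F)) (h : ∀ x, Ψ x = ∫ s, Φ (s, x) ∂μ)
    (hT : ∀ s, T (sliceCLM s Φ) = 0) : T Ψ = 0 := by
  obtain ⟨t, C, _, hC⟩ := Seminorm.bound_of_continuous (schwartz_withSeminorms ℝ E F)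
    ((normSeminorm ℝ G).comp T.toLinearMap) (by exact T.continuous.norm)
  let J : 𝓢(E, F) →L[ℝ] ((i : t) → BoundedContinuousFunction E (E [×i.1.2]→L[ℝ] F)) :=
    ContinuousLinearMap.pi fun i => weightedDerivCLM i.1.1 i.1.2
  have hJ (φ : 𝓢(E, F)) : ‖T φ‖ ≤ C * ‖J φ‖ := by
    refine (hC φ).trans ?_
    rw [_root_.smul_apply, NNReal.smul_def, smul_eq_mul]
    gcongr
    refine Seminorm.finset_sup_apply_le (norm_nonneg _) fun i hi => ?_
    exact (seminorm_le_norm_weightedDerivCLM i.1 i.2 φ).trans (norm_le_pi_norm (J φ) ⟨i, hi⟩)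
  have hint := integrable_apply_sliceCLM
    (G := (i : t) → BoundedContinuousFunction E (E [×i.1.2]→L[ℝ] F)) μ J Φ
  have hJΨ : J Ψ = ∫ s, J (sliceCLM s Φ) ∂μ := by
    ext1 i
    ext1 x
    let e : ((i : t) → BoundedContinuousFunction E (E [×i.1.2]→L[ℝ] F)) →L[ℝ]
        (E [×i.1.2]→L[ℝ] F) := (BoundedContinuousFunction.evalCLM ℝ x).comp
      (ContinuousLinearMap.proj (R := ℝ) (φ := fun i : t =>
        BoundedContinuousFunction E (E [×i.1.2]→L[ℝ] F)) i)
    have h1 := ContinuousLinearMap.integral_comp_comm (𝕜 := ℝ) (Fₗ := E [×i.1.2]→L[ℝ] F) e hint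
    refine Eq.trans ?_ h1
    change ‖x‖ ^ i.1.1 • iteratedFDeriv ℝ i.1.2 Ψ x =
      ∫ s, ‖x‖ ^ i.1.1 • iteratedFDeriv ℝ i.1.2 (sliceCLM s Φ) x ∂μ
    rw [integral_smul, iteratedFDeriv_eq_integral_sliceCLM μ i.1.2 Φ Ψ h x]
  exact map_eq_zero_of_integral_eq (μ := μ)
    (B := (i : t) → BoundedContinuousFunction E (E [×i.1.2]→L[ℝ] F)) (φ := fun s => sliceCLM s Φ)
    J.toLinearMap T.toLinearMap C.coe_nonneg hJ (by exact hint) (by exact hJΨ) hT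

section
variable {V : Type} [NormedAddCommGroup V] [InnerProductSpace ℝ V]

/-- The Schwartz function `(z, x) ↦ ⟪ξ, x⟫ ^ k * exp (z * ⟪ξ, x⟫ - ε * ‖x‖ ^ 2 - K * ‖z‖ ^ 2)` on
`ℂ × V`, for `K` large enough. -/
theorem exists_schwartzMap_pow_mul_exp_inner (ξ : V) {ε : ℝ} (hε : 0 < ε) :
    ∃ (K : ℝ) (Φ : ℕ → 𝓢(ℂ × V, ℂ)), ∀ k z x, Φ k (z, x) = (inner ℝ ξ x : ℂ) ^ k *
      Complex.exp (z * (inner ℝ ξ x : ℝ) - (ε * ‖x‖ ^ 2 + K * ‖z‖ ^ 2 : ℝ)) := by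
  set K := ‖ξ‖ ^ 2 / (2 * ε) + ε / 2 with hK
  have hr : (fun y : ℂ × V => inner ℝ ξ y.2).HasTemperateGrowth :=
    (Function.hasTemperateGrowth_inner_right ξ).comp
      (ContinuousLinearMap.snd ℝ ℂ V).hasTemperateGrowth
  have hre : (fun y : ℂ × V => y.1.re).HasTemperateGrowth :=
    Complex.reCLM.hasTemperateGrowth.comp (ContinuousLinearMap.fst ℝ ℂ V).hasTemperateGrowth
  have him : (fun y : ℂ × V => y.1.im).HasTemperateGrowth :=
    Complex.imCLM.hasTemperateGrowth.comp (ContinuousLinearMap.fst ℝ ℂ V).hasTemperateGrowth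
  have hx : (fun y : ℂ × V => ‖y.2‖ ^ 2).HasTemperateGrowth :=
    (Function.hasTemperateGrowth_norm_sq V).comp (ContinuousLinearMap.snd ℝ ℂ V).hasTemperateGrowth
  have hz : (fun y : ℂ × V => ‖y.1‖ ^ 2).HasTemperateGrowth :=
    (Function.hasTemperateGrowth_norm_sq ℂ).comp (ContinuousLinearMap.fst ℝ ℂ V).hasTemperateGrowth
  have hq : (fun y : ℂ × V => ε * ‖y.2‖ ^ 2 + K * ‖y.1‖ ^ 2 -
      y.1.re * inner ℝ ξ y.2).HasTemperateGrowth :=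
    (((Function.HasTemperateGrowth.const ε).mul hx).add
      ((Function.HasTemperateGrowth.const K).mul hz)).sub (hre.mul hr)
  obtain ⟨f, hf⟩ := exists_schwartzMap_eq_exp_neg_of_norm_sq_le hq (half_pos hε) (fun y => by
    have h1 : y.1.re * inner ℝ ξ y.2 ≤ ‖y.1‖ * (‖ξ‖ * ‖y.2‖) := by
      refine (le_abs_self _).trans ?_
      rw [abs_mul]
      gcongr
      · exact Complex.abs_re_le_norm _
      · exact abs_real_inner_le_norm _ _
    have h2 : ‖y.1‖ * (‖ξ‖ * ‖y.2‖) ≤ ‖ξ‖ ^ 2 / (2 * ε) * ‖y.1‖ ^ 2 + ε / 2 * ‖y.2‖ ^ 2 := by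
      have h3 : ‖ξ‖ ^ 2 / (2 * ε) * ‖y.1‖ ^ 2 + ε / 2 * ‖y.2‖ ^ 2 - ‖y.1‖ * (‖ξ‖ * ‖y.2‖) =
          (‖ξ‖ * ‖y.1‖ - ε * ‖y.2‖) ^ 2 / (2 * ε) := by
        field_simp
        ring
      have h4 : 0 ≤ (‖ξ‖ * ‖y.1‖ - ε * ‖y.2‖) ^ 2 / (2 * ε) := by positivity
      linarith
    have h5 : ‖y‖ ^ 2 ≤ ‖y.1‖ ^ 2 + ‖y.2‖ ^ 2 := by
      rw [Prod.norm_def]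
      rcases max_choice ‖y.1‖ ‖y.2‖ with h | h <;> rw [h] <;>
        nlinarith [sq_nonneg ‖y.1‖, sq_nonneg ‖y.2‖]
    have h6 : ε / 2 * ‖y‖ ^ 2 ≤ ε / 2 * (‖y.1‖ ^ 2 + ‖y.2‖ ^ 2) := by gcongr
    rw [hK]
    linarith)
  have hm (k : ℕ) : (fun y : ℂ × V => ((inner ℝ ξ y.2 : ℝ) : ℂ) ^ k *
      Complex.exp ((y.1.im * inner ℝ ξ y.2 : ℝ) * Complex.I)).HasTemperateGrowth :=
    ((Function.Complex.hasTemperateGrowth_ofReal.comp hr).pow k).mul (him.mul hr).cexp_mul_I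
  refine ⟨K, fun k => smulLeftCLM ℂ (fun y : ℂ × V => ((inner ℝ ξ y.2 : ℝ) : ℂ) ^ k *
      Complex.exp ((y.1.im * inner ℝ ξ y.2 : ℝ) * Complex.I)) f, fun k z x => ?_⟩
  rw [smulLeftCLM_apply_apply (hm k), hf, smul_eq_mul, mul_assoc, Complex.ofReal_exp,
    ← Complex.exp_add]
  congr 2
  push_cast
  linear_combination ((inner ℝ ξ x : ℝ) : ℂ) * Complex.re_add_im z

theorem lineDerivOp_pow_mul_exp_inner {ξ : V} {ε K : ℝ} {Φ : ℕ → 𝓢(ℂ × V, ℂ)}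
    (h : ∀ k z x, Φ k (z, x) = (inner ℝ ξ x : ℂ) ^ k *
      Complex.exp (z * (inner ℝ ξ x : ℝ) - (ε * ‖x‖ ^ 2 + K * ‖z‖ ^ 2 : ℝ))) (k : ℕ) (v : ℂ)
    (z : ℂ) (x : V) :
    (∂_{((v, 0) : ℂ × V)} (Φ k)) (z, x) =
      v * Φ (k + 1) (z, x) - (2 * K * inner ℝ z v : ℝ) * Φ k (z, x) := by
  rw [lineDerivOp_apply_eq_fderiv]
  have h1 : HasDerivAt (fun t : ℝ => ((z, x) : ℂ × V) + t • ((v, 0) : ℂ × V)) (v, 0) 0 := by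
    simpa using ((hasDerivAt_id (0 : ℝ)).smul_const ((v, 0) : ℂ × V)).const_add (z, x)
  have h2 := HasFDerivAt.comp_hasDerivAt_of_eq (0 : ℝ) ((Φ k).hasFDerivAt (z, x)) h1 (by simp)
  refine h2.unique ?_
  have h3 : HasDerivAt (fun t : ℝ => z + t * v) v 0 := by
    simpa using ((hasDerivAt_id (0 : ℝ)).ofReal_comp.mul_const v).const_add z
  have h4 : HasDerivAt (fun t : ℝ => ‖z + t * v‖ ^ 2) (2 * inner ℝ z v) 0 := by
    simpa using h3.norm_sq
  have h5 := ((h3.mul_const ((inner ℝ ξ x : ℝ) : ℂ)).fun_sub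
    ((h4.const_mul K).const_add (ε * ‖x‖ ^ 2)).ofReal_comp).cexp.const_mul
      (((inner ℝ ξ x : ℝ) : ℂ) ^ k)
  refine (h5.congr_deriv ?_).congr_of_eventuallyEq (.of_forall fun t => ?_)
  · simp [h]
    ring
  · simp [h]

theorem map_exp_inner_eq_zero (T : 𝓢(V, ℂ) →L[ℂ] ℂ) (ξ : V) {ε : ℝ} (hε : 0 < ε)
    (hT : ∀ (k : ℕ) (φ : 𝓢(V, ℂ)), (∀ x, φ x = (inner ℝ ξ x : ℂ) ^ k *
      (Real.exp (-(ε * ‖x‖ ^ 2)) : ℝ)) → T φ = 0) (φ : 𝓢(V, ℂ)) (z : ℂ)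
    (hφ : ∀ x, φ x = Complex.exp (z * (inner ℝ ξ x : ℝ)) * (Real.exp (-(ε * ‖x‖ ^ 2)) : ℝ)) :
    T φ = 0 := by
  obtain ⟨K, Φ, hΦ⟩ := exists_schwartzMap_pow_mul_exp_inner ξ hε
  set u : ℕ → ℂ → ℂ := fun k z =>
    (Real.exp (K * ‖z‖ ^ 2) : ℝ) * T (sliceCLM z (Φ k)) with hu
  have hd (k : ℕ) (z : ℂ) : HasDerivAt (u k) (u (k + 1) z) z := by
    obtain ⟨L, hL, hL'⟩ := exists_hasFDerivAt_sliceCLM (T.restrictScalars ℝ) (Φ k) z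
    have h1 : HasFDerivAt (fun z : ℂ => ((Real.exp (K * ‖z‖ ^ 2) : ℝ) : ℂ)) _ z :=
      Complex.ofRealCLM.hasFDerivAt.comp z
        ((((hasStrictFDerivAt_norm_sq z).hasFDerivAt).const_mul K).exp)
    rw [hasDerivAt_iff_hasFDerivAt]
    refine hasFDerivAt_of_restrictScalars ℝ (h1.mul hL') ?_
    ext1 v
    have h2 : sliceCLM z (∂_{((v, 0) : ℂ × V)} (Φ k)) =
        v • sliceCLM z (Φ (k + 1)) - ((2 * K * inner ℝ z v : ℝ) : ℂ) • sliceCLM z (Φ k) := by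
      ext x
      simp [lineDerivOp_pow_mul_exp_inner hΦ]
    have h3 := hL v
    rw [h2] at h3
    simp [h3, hu]
    ring
  have hit (n : ℕ) : iteratedDeriv n (u 0) = u n := by
    induction n with
    | zero => simp
    | succ n ih => rw [iteratedDeriv_succ, ih]; exact funext fun z => (hd n z).deriv
  have h0 (n : ℕ) : u n 0 = 0 := by
    simp only [hu, mul_eq_zero]
    refine Or.inr (hT n _ fun x => ?_)
    rw [sliceCLM_apply, hΦ]
    simp
  have := Complex.taylorSeries_eq_of_entire' (f := u 0) 0 z
    (fun z => (hd 0 z).differentiableAt)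
  simp only [hit, h0, mul_zero, zero_mul, tsum_zero] at this
  rw [this]
  simp only [hu]
  rw [← smul_eq_mul, ← map_smul]
  congr 1
  ext x
  rw [_root_.smul_apply, sliceCLM_apply, hΦ, hφ]
  simp only [pow_zero, one_mul, smul_eq_mul, Complex.ofReal_exp, ← Complex.exp_add]
  congr 1
  push_cast
  ring

variable [FiniteDimensional ℝ V] [MeasurableSpace V] [BorelSpace V]

open FourierTransform in
theorem map_mul_gaussian_eq_zero (T : 𝓢(V, ℂ) →L[ℂ] ℂ) {ε : ℝ} (hε : 0 < ε)
    (hT : ∀ (ξ : V) (k : ℕ) (φ : 𝓢(V, ℂ)), (∀ x, φ x = (inner ℝ ξ x : ℂ) ^ k *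
      (Real.exp (-(ε * ‖x‖ ^ 2)) : ℝ)) → T φ = 0) (φ ψ : 𝓢(V, ℂ))
    (hψ : ∀ x, ψ x = (Real.exp (-(ε * ‖x‖ ^ 2)) : ℝ) * φ x) : T ψ = 0 := by
  obtain ⟨g, hg⟩ := exists_schwartzMap_eq_exp_neg_of_norm_sq_le (E := V)
    (q := fun x => ε * ‖x‖ ^ 2)
    ((Function.HasTemperateGrowth.const ε).mul (Function.hasTemperateGrowth_norm_sq V)) hε
    fun x => le_rfl
  have hin : (fun y : V × V => 2 * Real.pi * inner ℝ y.1 y.2).HasTemperateGrowth :=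
    (Function.HasTemperateGrowth.const _).mul ((innerSL ℝ).bilinear_hasTemperateGrowth
      (ContinuousLinearMap.fst ℝ V V).hasTemperateGrowth
      (ContinuousLinearMap.snd ℝ V V).hasTemperateGrowth)
  refine map_eq_zero_of_sliceCLM volume (T.restrictScalars ℝ)
    (smulLeftCLM ℂ (fun y : V × V => Complex.exp ((2 * Real.pi * inner ℝ y.1 y.2 : ℝ) * Complex.I))
      (exteriorProduct (𝓕 φ) g)) ψ (fun x => ?_) fun s => ?_
  · have h1 : φ x = 𝓕⁻ (𝓕 φ) x := by rw [FourierPair.fourierInv_fourier_eq]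
    rw [hψ, h1, fourierInv_coe, Real.fourierInv_eq', ← integral_const_mul]
    congr 1 with s
    rw [smulLeftCLM_apply_apply hin.cexp_mul_I, exteriorProduct_apply, hg]
    simp
    ring
  · obtain ⟨f, hf⟩ : ∃ f : 𝓢(V, ℂ), ∀ x, f x = Complex.exp ((2 * Real.pi * Complex.I) *
      (inner ℝ s x : ℝ)) * (Real.exp (-(ε * ‖x‖ ^ 2)) : ℝ) := by
      have hs : (fun x : V => 2 * Real.pi * inner ℝ s x).HasTemperateGrowth :=
        (Function.HasTemperateGrowth.const _).mul (Function.hasTemperateGrowth_inner_right s)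
      refine ⟨smulLeftCLM ℂ (fun x => Complex.exp ((2 * Real.pi * inner ℝ s x : ℝ) * Complex.I)) g,
        fun x => ?_⟩
      rw [smulLeftCLM_apply_apply hs.cexp_mul_I, hg, smul_eq_mul]
      congr 2
      push_cast
      ring
    have h1 := map_exp_inner_eq_zero T s hε (hT s) f _ hf
    have h2 : sliceCLM s (smulLeftCLM ℂ (fun y : V × V =>
        Complex.exp ((2 * Real.pi * inner ℝ y.1 y.2 : ℝ) * Complex.I))
        (exteriorProduct (𝓕 φ) g)) = 𝓕 φ s • f := by
      ext x
      rw [sliceCLM_apply, smulLeftCLM_apply_apply hin.cexp_mul_I, exteriorProduct_apply, hg,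
        _root_.smul_apply, hf]
      simp
      ring_nf
    rw [ContinuousLinearMap.coe_restrictScalars', h2, map_smul, h1, smul_zero]

/-- A tempered distribution is determined by its values on the functions
`⟪ξ, x⟫ ^ k * exp (-ε * ‖x‖ ^ 2)`. -/
theorem map_eq_zero_of_pow_inner_mul_gaussian (T : 𝓢(V, ℂ) →L[ℂ] ℂ)
    (hT : ∀ ε : ℝ, 0 < ε → ∀ (ξ : V) (k : ℕ) (φ : 𝓢(V, ℂ)), (∀ x, φ x = (inner ℝ ξ x : ℂ) ^ k *
      (Real.exp (-(ε * ‖x‖ ^ 2)) : ℝ)) → T φ = 0) (φ : 𝓢(V, ℂ)) : T φ = 0 := by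
  obtain ⟨χ, hχ⟩ := exists_schwartzMap_eq_exp_neg_of_norm_sq_le (E := ℝ) (q := fun x => ‖x‖ ^ 2)
    (Function.hasTemperateGrowth_norm_sq ℝ) one_pos fun x => by simp
  have hq : (fun y : ℝ × V => ‖y.1‖ ^ 2 * ‖y.2‖ ^ 2).HasTemperateGrowth :=
    ((Function.hasTemperateGrowth_norm_sq ℝ).comp
      (ContinuousLinearMap.fst ℝ ℝ V).hasTemperateGrowth).mul
    ((Function.hasTemperateGrowth_norm_sq V).comp
      (ContinuousLinearMap.snd ℝ ℝ V).hasTemperateGrowth)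
  have hm := hq.exp_neg fun _ => by positivity
  set Φ := smulLeftCLM ℂ (fun y : ℝ × V => ((Real.exp (-(‖y.1‖ ^ 2 * ‖y.2‖ ^ 2)) : ℝ) : ℂ))
    (exteriorProduct χ φ) with hΦ
  have hΦa (s : ℝ) (x : V) : Φ (s, x) = (Real.exp (-(‖s‖ ^ 2 * ‖x‖ ^ 2)) : ℝ) * (χ s * φ x) := by
    rw [hΦ, smulLeftCLM_apply_apply hm, exteriorProduct_apply, smul_eq_mul]
  have hc := continuous_apply_sliceCLM (T.restrictScalars ℝ) Φ
  have h0 : ∀ s : ℝ, s ≠ 0 → T (sliceCLM s Φ) = 0 := fun s hs => by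
    refine map_mul_gaussian_eq_zero T (ε := ‖s‖ ^ 2) (by positivity) (hT _ (by positivity))
      (χ s • φ) _ fun x => ?_
    rw [sliceCLM_apply, hΦa, _root_.smul_apply, smul_eq_mul]
  have h1 : T (sliceCLM 0 Φ) = 0 := by
    have hcl : IsClosed {s : ℝ | T (sliceCLM s Φ) = 0} := isClosed_eq hc continuous_const
    have hsub : ({0}ᶜ : Set ℝ) ⊆ {s : ℝ | T (sliceCLM s Φ) = 0} := fun s hs => h0 s hs
    exact hcl.closure_subset_iff.2 hsub
      (by rw [(dense_compl_singleton (0 : ℝ)).closure_eq]; trivial)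
  rw [← h1]
  congr 1
  ext x
  rw [sliceCLM_apply, hΦa, hχ]
  simp

end

section
variable {κ : Type} [Fintype κ] [DecidableEq κ]

theorem eq_top_of_square_zero_mem (p : Submodule ℝ (Matrix κ κ ℝ)) (h1 : 1 ∈ p)
    (h : ∀ Z : Matrix κ κ ℝ, Z * Z = 0 → Z ∈ p) : p = ⊤ := by
  have hoff (a b : κ) (hab : a ≠ b) : single a b (1 : ℝ) ∈ p :=
    h _ (by rw [single_mul_single_of_ne]; exact hab.symm)
  have hdiff (a b : κ) : single a a (1 : ℝ) - single b b (1 : ℝ) ∈ p := by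
    by_cases hab : a = b
    · simp [hab]
    have h2 : single a a (1 : ℝ) - single b b 1 - single a b 1 + single b a 1 ∈ p := by
      refine h _ ?_
      simp [mul_add, add_mul, mul_sub, sub_mul, single_mul_single_of_ne, hab, Ne.symm hab]
      abel
    have h3 := p.sub_mem (p.add_mem h2 (hoff a b hab)) (hoff b a (Ne.symm hab))
    convert h3 using 1
    abel
  have hdiag (a : κ) : single a a (1 : ℝ) ∈ p := by
    have h2 : (Fintype.card κ : ℝ) • single a a (1 : ℝ) ∈ p := by
      have h3 : (Fintype.card κ : ℝ) • single a a (1 : ℝ) =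
          ∑ b, (single a a (1 : ℝ) - single b b 1) + 1 := by
        rw [Finset.sum_sub_distrib, ← Matrix.sum_single_one]
        simp [← Nat.cast_smul_eq_nsmul ℝ]
      rw [h3]
      exact p.add_mem (p.sum_mem fun b _ => hdiff a b) h1
    have hc : (Fintype.card κ : ℝ) ≠ 0 := by
      have : Nonempty κ := ⟨a⟩
      exact_mod_cast Fintype.card_ne_zero
    exact (p.smul_mem_iff hc).1 h2
  refine eq_top_iff.2 fun Z _ => ?_
  rw [Matrix.matrix_eq_sum_single Z]
  refine p.sum_mem fun i _ => p.sum_mem fun j _ => ?_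
  have h2 : single i j (Z i j) = Z i j • single i j (1 : ℝ) := by simp
  rw [h2]
  refine p.smul_mem _ ?_
  by_cases hij : i = j
  · subst hij
    exact hdiag i
  · exact hoff i j hij

/-- The map `x ↦ Z * x - x * Z`. -/
noncomputable def commutatorCLM (Z : Matrix κ κ ℝ) : Matrix κ κ ℝ →L[ℝ] Matrix κ κ ℝ :=
  LinearMap.toContinuousLinearMap (LinearMap.mulLeft ℝ Z - LinearMap.mulRight ℝ Z)

theorem commutatorCLM_apply (Z x : Matrix κ κ ℝ) : commutatorCLM Z x = Z * x - x * Z := rfl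

/-- The derivative of a Schwartz function along the infinitesimal conjugation by `Z`. -/
noncomputable def conjDeriv (Z : Matrix κ κ ℝ) (φ : 𝓢(Matrix κ κ ℝ, ℂ)) : 𝓢(Matrix κ κ ℝ, ℂ) :=
  bilinLeftCLM (ContinuousLinearMap.id ℝ (Matrix κ κ ℝ →L[ℝ] ℂ))
    (commutatorCLM Z).hasTemperateGrowth (fderivCLM ℝ (Matrix κ κ ℝ) ℂ φ)

theorem conjDeriv_apply (Z : Matrix κ κ ℝ) (φ : 𝓢(Matrix κ κ ℝ, ℂ)) (x : Matrix κ κ ℝ) :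
    conjDeriv Z φ x = fderiv ℝ φ x (commutatorCLM Z x) := rfl

theorem one_add_smul_conj (Z : Matrix κ κ ℝ) (s : ℝ) (x : Matrix κ κ ℝ) :
    x + s • commutatorCLM Z x - s ^ 2 • (Z * (x * Z)) = (1 + s • Z) * x * (1 - s • Z) := by
  rw [commutatorCLM_apply]
  simp only [add_mul, mul_sub, one_mul, mul_one, smul_mul_assoc, mul_smul_comm, mul_assoc,
      pow_two]
  module

theorem exists_nonneg_forall_norm_le {E F : Type*} [NormedAddCommGroup E] [NormedSpace ℝ E]
    [NormedAddCommGroup F] [NormedSpace ℝ F] (f : E →L[ℝ] F) :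
    ∃ A, 0 ≤ A ∧ ∀ x, ‖f x‖ ≤ A * ‖x‖ :=
  ⟨‖f‖, norm_nonneg f, f.le_opNorm⟩

theorem exists_schwartzMap_conj_one_add_smul (Z : Matrix κ κ ℝ) (hZ : Z * Z = 0)
    (φ : 𝓢(Matrix κ κ ℝ, ℂ)) (χ : 𝓢(ℝ, ℂ)) :
    ∃ Φ : 𝓢(ℝ × Matrix κ κ ℝ, ℂ), ∀ s x,
      Φ (s, x) = χ s * φ ((1 + s • Z) * x * (1 - s • Z)) := by
  let Q : Matrix κ κ ℝ →L[ℝ] Matrix κ κ ℝ := LinearMap.toContinuousLinearMap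
    (LinearMap.mulLeft ℝ Z ∘ₗ LinearMap.mulRight ℝ Z)
  have hQ (x : Matrix κ κ ℝ) : Q x = Z * (x * Z) := rfl
  have hfst := (ContinuousLinearMap.fst ℝ ℝ (Matrix κ κ ℝ)).hasTemperateGrowth
  have hg : (fun y : ℝ × Matrix κ κ ℝ => ContinuousLinearMap.inl ℝ ℝ (Matrix κ κ ℝ) y.1 +
      ContinuousLinearMap.inr ℝ ℝ (Matrix κ κ ℝ)
        (y.2 + y.1 • commutatorCLM Z y.2 - y.1 ^ 2 • Q y.2)).HasTemperateGrowth := by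
    have hsnd := (ContinuousLinearMap.snd ℝ ℝ (Matrix κ κ ℝ)).hasTemperateGrowth
    refine Function.HasTemperateGrowth.add
      ((ContinuousLinearMap.inl ℝ ℝ (Matrix κ κ ℝ)).hasTemperateGrowth.comp hfst)
      ((ContinuousLinearMap.inr ℝ ℝ (Matrix κ κ ℝ)).hasTemperateGrowth.comp ?_)
    exact (hsnd.add (hfst.smul ((commutatorCLM Z).hasTemperateGrowth.comp hsnd))).sub
      ((hfst.pow 2).smul (Q.hasTemperateGrowth.comp hsnd))
  have hconj (s : ℝ) (x : Matrix κ κ ℝ) :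
      x + s • commutatorCLM Z x - s ^ 2 • Q x = (1 + s • Z) * x * (1 - s • Z) :=
    one_add_smul_conj Z s x
  have hup : ∃ (k : ℕ) (C : ℝ), ∀ y : ℝ × Matrix κ κ ℝ, ‖y‖ ≤ C *
      (1 + ‖ContinuousLinearMap.inl ℝ ℝ (Matrix κ κ ℝ) y.1 +
      ContinuousLinearMap.inr ℝ ℝ (Matrix κ κ ℝ)
        (y.2 + y.1 • commutatorCLM Z y.2 - y.1 ^ 2 • Q y.2)‖) ^ k := by
    obtain ⟨A, hA, hAZ⟩ := exists_nonneg_forall_norm_le (commutatorCLM Z)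
    obtain ⟨B, hB, hBQ⟩ := exists_nonneg_forall_norm_le Q
    refine ⟨3, 1 + A + B, fun y => ?_⟩
    obtain ⟨s, x⟩ := y
    simp only [hconj]
    set x' := (1 + s • Z) * x * (1 - s • Z) with hx'
    have hx : x = x' + (-s) • commutatorCLM Z x' - (-s) ^ 2 • Q x' := by
      rw [hconj, hx']
      have e1 : (1 + -s • Z) * (1 + s • Z) = 1 := by simp [add_mul, mul_add, hZ]
      have e2 : (1 - s • Z) * (1 - -s • Z) = 1 := by simp [sub_mul, mul_add, hZ]
      calc x = 1 * x * 1 := by simp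
        _ = ((1 + -s • Z) * (1 + s • Z)) * x * ((1 - s • Z) * (1 - -s • Z)) := by rw [e1, e2]
        _ = _ := by simp only [mul_assoc]
    have hw : ContinuousLinearMap.inl ℝ ℝ (Matrix κ κ ℝ) s +
      ContinuousLinearMap.inr ℝ ℝ (Matrix κ κ ℝ) x' = (s, x') := by simp
    rw [hw]
    set w := ‖(s, x')‖ with hw'
    have hs : |s| ≤ w := norm_fst_le (s, x')
    have hxw : ‖x'‖ ≤ w := norm_snd_le (s, x')
    have hw0 : 0 ≤ w := norm_nonneg _
    have b1 : ‖x‖ ≤ w + w * (A * w) + w ^ 2 * (B * w) := by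
      rw [hx]
      refine (norm_sub_le _ _).trans (add_le_add ((norm_add_le _ _).trans (add_le_add hxw ?_)) ?_)
      · rw [norm_smul, norm_neg, Real.norm_eq_abs]
        gcongr
        exact (hAZ _).trans (by gcongr)
      · rw [norm_smul, norm_pow, norm_neg, Real.norm_eq_abs]
        gcongr
        exact (hBQ _).trans (by gcongr)
    have c1 : w ≤ (1 + w) ^ 3 := by nlinarith [pow_nonneg hw0 2, pow_nonneg hw0 3]
    have c2 : w ^ 2 ≤ (1 + w) ^ 3 := by nlinarith [pow_nonneg hw0 2, pow_nonneg hw0 3]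
    have c3 : w ^ 3 ≤ (1 + w) ^ 3 := by gcongr; linarith
    have d2 := mul_le_mul_of_nonneg_left c2 hA
    have d3 := mul_le_mul_of_nonneg_left c3 hB
    have d4 : 0 ≤ A * (1 + w) ^ 3 + B * (1 + w) ^ 3 := by positivity
    rw [Prod.norm_def]
    refine max_le ?_ ?_
    · change |s| ≤ _
      linarith
    · change ‖x‖ ≤ _
      linarith
  refine ⟨compCLM ℝ hg hup (exteriorProduct χ φ), fun s x => ?_⟩
  rw [← hconj]
  simp

theorem lineDerivOp_fst_eq_fderiv {E : Type*} [NormedAddCommGroup E] [NormedSpace ℝ E]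
    {Φ : 𝓢(ℝ × E, ℂ)} {φ : 𝓢(E, ℂ)} {χ : 𝓢(ℝ, ℂ)} {a : ℝ → E} {x v : E} (hχ0 : χ 0 = 1)
    (hχ : HasDerivAt χ 0 0) (ha0 : a 0 = x) (ha : HasDerivAt a v 0)
    (h : ∀ t, Φ (t, x) = χ t * φ (a t)) :
    (∂_{((1, 0) : ℝ × E)} Φ) (0, x) = fderiv ℝ φ x v := by
  rw [lineDerivOp_apply_eq_fderiv]
  have h1 : HasDerivAt (fun t : ℝ => ((0, x) : ℝ × E) + t • ((1, 0) : ℝ × E)) (1, 0) 0 := by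
    simpa only [one_smul, id_eq] using
      ((hasDerivAt_id (0 : ℝ)).smul_const ((1, 0) : ℝ × E)).const_add (0, x)
  have h2 := HasFDerivAt.comp_hasDerivAt_of_eq (0 : ℝ) (Φ.hasFDerivAt (0, x)) h1 (by simp)
  refine h2.unique ?_
  have h5 := HasFDerivAt.comp_hasDerivAt_of_eq (0 : ℝ) (φ.hasFDerivAt x) ha ha0.symm
  refine ((hχ.mul h5).congr_deriv (by simp [hχ0])).congr_of_eventuallyEq (.of_forall fun t => ?_)
  simp [h]

theorem map_conjDeriv_eq_zero_of_mul_self_eq_zero (D : 𝓢(Matrix κ κ ℝ, ℂ) →L[ℂ] ℂ)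
    (hD : ∀ (g : (Matrix κ κ ℝ)ˣ) (φ ψ : 𝓢(Matrix κ κ ℝ, ℂ)),
      (∀ x, ψ x = φ ((g : Matrix κ κ ℝ) * x * (↑g⁻¹ : Matrix κ κ ℝ))) → D ψ = D φ)
    (Z : Matrix κ κ ℝ) (hZ : Z * Z = 0) (φ : 𝓢(Matrix κ κ ℝ, ℂ)) : D (conjDeriv Z φ) = 0 := by
  obtain ⟨χ, hχ⟩ := exists_schwartzMap_eq_exp_neg_of_norm_sq_le (E := ℝ) (q := fun x => ‖x‖ ^ 2)
    (Function.hasTemperateGrowth_norm_sq ℝ) one_pos fun x => by simp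
  have hχ0 : χ 0 = 1 := by simp [hχ]
  have hχd : HasDerivAt χ 0 0 := by
    have h1 : HasDerivAt (fun s : ℝ => ((Real.exp (-(s ^ 2)) : ℝ) : ℂ)) _ 0 :=
      (((hasDerivAt_pow 2 (0 : ℝ)).fun_neg).exp).ofReal_comp
    have h2 : ⇑χ = fun s : ℝ => ((Real.exp (-(s ^ 2)) : ℝ) : ℂ) := by
      funext s
      simp [hχ]
    rw [h2]
    exact h1.congr_deriv (by simp)
  obtain ⟨Φ, hΦ⟩ := exists_schwartzMap_conj_one_add_smul Z hZ φ χ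
  obtain ⟨L, hL, hL'⟩ := exists_hasFDerivAt_sliceCLM (D.restrictScalars ℝ) Φ 0
  have hu (s : ℝ) : D (sliceCLM s Φ) = χ s * D φ := by
    let g : (Matrix κ κ ℝ)ˣ :=
      ⟨1 + s • Z, 1 - s • Z, by simp [add_mul, mul_sub, hZ], by simp [sub_mul, mul_add, hZ]⟩
    rw [← smul_eq_mul, ← map_smul]
    refine hD g _ _ fun x => ?_
    rw [sliceCLM_apply, hΦ, _root_.smul_apply, smul_eq_mul]
    rfl
  have hL0 : L 1 = 0 := by
    have h1 : HasDerivAt (fun s : ℝ => χ s * D φ) (L 1) 0 := by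
      simpa only [ContinuousLinearMap.coe_restrictScalars', hu] using hL'.hasDerivAt
    simpa using h1.unique (hχd.mul_const (D φ))
  rw [hL] at hL0
  rw [← hL0, ContinuousLinearMap.coe_restrictScalars']
  congr 1
  ext x
  rw [sliceCLM_apply, conjDeriv_apply]
  have h3 : HasDerivAt (fun t : ℝ => x + t • commutatorCLM Z x - t ^ 2 • (Z * (x * Z)))
      (commutatorCLM Z x) 0 := by
    have h4 := (((hasDerivAt_id (0 : ℝ)).smul_const (commutatorCLM Z x)).const_add x).fun_sub
      ((hasDerivAt_pow 2 (0 : ℝ)).smul_const (Z * (x * Z)))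
    exact h4.congr_deriv (by simp)
  refine (lineDerivOp_fst_eq_fderiv hχ0 hχd (by simp) h3 fun t => ?_).symm
  rw [hΦ, one_add_smul_conj]

theorem map_conjDeriv_eq_zero (D : 𝓢(Matrix κ κ ℝ, ℂ) →L[ℂ] ℂ)
    (hD : ∀ (g : (Matrix κ κ ℝ)ˣ) (φ ψ : 𝓢(Matrix κ κ ℝ, ℂ)),
      (∀ x, ψ x = φ ((g : Matrix κ κ ℝ) * x * (↑g⁻¹ : Matrix κ κ ℝ))) → D ψ = D φ)
    (Z : Matrix κ κ ℝ) (φ : 𝓢(Matrix κ κ ℝ, ℂ)) : D (conjDeriv Z φ) = 0 := by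
  let p : Submodule ℝ (Matrix κ κ ℝ) :=
    { carrier := {Z | D (conjDeriv Z φ) = 0}
      zero_mem' := by
        have h : conjDeriv 0 φ = 0 := by
          ext x
          simp [conjDeriv_apply, commutatorCLM_apply]
        simp [h]
      add_mem' := fun {Y Z} hY hZ => by
        have h : conjDeriv (Y + Z) φ = conjDeriv Y φ + conjDeriv Z φ := by
          ext x
          rw [_root_.add_apply]
          simp only [conjDeriv_apply, ← map_add]
          congr 1
          simp only [commutatorCLM_apply, add_mul, mul_add]
          abel
        simp only [Set.mem_ofPred_eq] at hY hZ ⊢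
        rw [h, map_add, hY, hZ, add_zero]
      smul_mem' := fun c Z hZ => by
        have h : conjDeriv (c • Z) φ = (c : ℂ) • conjDeriv Z φ := by
          ext x
          rw [_root_.smul_apply, Complex.coe_smul]
          simp only [conjDeriv_apply, ← map_smul]
          congr 1
          simp [commutatorCLM_apply, smul_sub]
        simp only [Set.mem_ofPred_eq] at hZ ⊢
        rw [h, map_smul, hZ, smul_zero] }
  have hp : p = ⊤ := by
    refine eq_top_of_square_zero_mem p ?_ fun Z hZ =>
      map_conjDeriv_eq_zero_of_mul_self_eq_zero D hD Z hZ φ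
    have h : conjDeriv 1 φ = 0 := by
      ext x
      simp [conjDeriv_apply, commutatorCLM_apply]
    change D (conjDeriv 1 φ) = 0
    rw [h, map_zero]
  have h : Z ∈ p := hp ▸ Submodule.mem_top
  exact h

end

theorem MvPolynomial.hasDerivAt_eval {σ : Type*} [Fintype σ] {γ : ℝ → σ → ℂ} {v : σ → ℂ} {t : ℝ}
    (h : ∀ p, HasDerivAt (fun s => γ s p) (v p) t) (P : MvPolynomial σ ℂ) :
    HasDerivAt (fun s => eval (γ s) P) (∑ p, v p * eval (γ t) (pderiv p P)) t := by
  classical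
  induction P using MvPolynomial.induction_on with
  | C a => simpa using hasDerivAt_const t a
  | add P Q hP hQ =>
    simpa [mul_add, Finset.sum_add_distrib] using hP.fun_add hQ
  | mul_X P p hP =>
    have h1 := hP.fun_mul (h p)
    simp only [map_mul, eval_X]
    refine h1.congr_deriv ?_
    simp only [Derivation.leibniz, pderiv_X, Pi.single_apply, smul_eq_mul, map_add, map_mul,
      mul_add, Finset.sum_add_distrib, eval_X, apply_ite (eval (γ t)), map_zero, mul_ite,
      mul_one, mul_zero, Finset.sum_ite_eq, Finset.mem_univ, if_true, Finset.sum_mul]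
    rw [add_comm]
    congr 1
    · simp [mul_comm]
    · exact Finset.sum_congr rfl fun q _ => by ring

theorem MvPolynomial.eval_aeval {σ τ R : Type*} [CommRing R] (f : σ → MvPolynomial τ R)
    (x : τ → R) (P : MvPolynomial σ R) :
    eval x (aeval f P) = eval (fun p => eval x (f p)) P := by
  induction P using MvPolynomial.induction_on with
  | C a => simp
  | add P Q hP hQ => rw [map_add, map_add, map_add, hP, hQ]
  | mul_X P p hP => rw [map_mul, map_mul, map_mul, hP, aeval_X, eval_X]

section
variable {κ : Type}

/-- The complex-valued function on real matrices attached to a polynomial in the entries. -/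
noncomputable def polynomialFun (P : MvPolynomial (κ × κ) ℂ) (x : Matrix κ κ ℝ) : ℂ :=
  MvPolynomial.eval (fun p => (x p.1 p.2 : ℂ)) P

theorem polynomialFun_transposeHom (P : MvPolynomial (κ × κ) ℂ) (x : Matrix κ κ ℝ) :
    polynomialFun (transposeHom κ P) x = polynomialFun P xᵀ := by
  rw [polynomialFun, transposeHom, MvPolynomial.eval_rename]
  rfl

variable [Fintype κ]

theorem polynomialFun_genericCommutator (i j : κ) (x : Matrix κ κ ℝ) :
    polynomialFun (genericCommutator κ i j) x = ((x * xᵀ - xᵀ * x) i j : ℝ) := by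
  simp [polynomialFun, genericCommutator, Matrix.mul_apply]

theorem hasTemperateGrowth_entry (i j : κ) :
    (fun x : Matrix κ κ ℝ => x i j).HasTemperateGrowth :=
  (LinearMap.toContinuousLinearMap (entryLinearMap ℝ ℝ i j)).hasTemperateGrowth

theorem hasTemperateGrowth_polynomialFun (P : MvPolynomial (κ × κ) ℂ) :
    (polynomialFun P).HasTemperateGrowth := by
  unfold polynomialFun
  induction P using MvPolynomial.induction_on with
  | C a => simpa only [MvPolynomial.eval_C] using Function.HasTemperateGrowth.const a
  | add P Q hP hQ =>
    simp only [map_add]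
    exact hP.add hQ
  | mul_X P p hP =>
    simp only [map_mul, MvPolynomial.eval_X]
    exact hP.mul (Function.Complex.hasTemperateGrowth_ofReal.comp
      (hasTemperateGrowth_entry p.1 p.2))

theorem exists_schwartzMap_matrix_gaussian (κ : Type) [Fintype κ] {ε : ℝ} (hε : 0 < ε) :
    ∃ G : 𝓢(Matrix κ κ ℝ, ℂ),
      ∀ x, G x = (Real.exp (-(ε * ∑ p : κ × κ, x p.1 p.2 ^ 2)) : ℝ) := by
  classical
  refine exists_schwartzMap_eq_exp_neg_of_norm_sq_le
    (q := fun x : Matrix κ κ ℝ => ε * ∑ p : κ × κ, x p.1 p.2 ^ 2) ?_ hε fun x => ?_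
  · exact (Function.HasTemperateGrowth.const ε).mul
      (Function.HasTemperateGrowth.sum fun p _ => (hasTemperateGrowth_entry p.1 p.2).pow 2)
  · refine mul_le_mul_of_nonneg_left ?_ hε.le
    have h0 : 0 ≤ ∑ p : κ × κ, x p.1 p.2 ^ 2 := Finset.sum_nonneg fun p _ => sq_nonneg _
    have h1 : ‖x‖ ≤ √(∑ p : κ × κ, x p.1 p.2 ^ 2) :=
      (Matrix.norm_le_iff (Real.sqrt_nonneg _)).2 fun i j => Real.abs_le_sqrt <|
        Finset.single_le_sum (f := fun p : κ × κ => x p.1 p.2 ^ 2) (fun p _ => sq_nonneg _)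
          (Finset.mem_univ (i, j))
    exact (pow_le_pow_left₀ (norm_nonneg x) h1 2).trans_eq (Real.sq_sqrt h0)

variable [DecidableEq κ]

theorem SchwartzMap.hasDerivAt_comp_add_smul {E : Type*} [NormedAddCommGroup E] [NormedSpace ℝ E]
    (φ : 𝓢(E, ℂ)) (x v : E) : HasDerivAt (fun t : ℝ => φ (x + t • v)) (fderiv ℝ φ x v) 0 := by
  have h1 : HasDerivAt (fun t : ℝ => x + t • v) v 0 := by
    simpa only [one_smul, id_eq] using ((hasDerivAt_id (0 : ℝ)).smul_const v).const_add x
  exact HasFDerivAt.comp_hasDerivAt_of_eq (0 : ℝ) (φ.hasFDerivAt x) h1 (by simp)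

theorem polynomialFun_commutatorDerivation (i j : κ) (P : MvPolynomial (κ × κ) ℂ)
    (x : Matrix κ κ ℝ) :
    polynomialFun (commutatorDerivation i j P) x =
      ∑ p : κ × κ, (commutatorCLM (single i j 1) x p.1 p.2 : ℂ) *
        polynomialFun (MvPolynomial.pderiv p P) x := by
  simp only [polynomialFun, commutatorDerivation_apply, map_sum, map_mul]
  refine Finset.sum_congr rfl fun p _ => ?_
  congr 1
  rw [commutatorCLM_apply, Matrix.sub_apply, Matrix.sub_apply, map_sub, Complex.ofReal_sub]
  simp only [Matrix.mul_apply, map_sum, Complex.ofReal_sum, map_mul, Complex.ofReal_mul,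
    mvPolynomialX_apply, MvPolynomial.eval_X, single_apply, apply_ite Complex.ofReal,
    apply_ite (MvPolynomial.eval _), map_one, map_zero, Complex.ofReal_one, Complex.ofReal_zero]

theorem sum_mul_commutatorCLM_single (i j : κ) (x : Matrix κ κ ℝ) :
    ∑ p : κ × κ, x p.1 p.2 * commutatorCLM (single i j 1) x p.1 p.2 =
      (x * xᵀ - xᵀ * x) j i := by
  have h1 : ∑ p : κ × κ, x p.1 p.2 * commutatorCLM (single i j 1) x p.1 p.2 =
      trace (xᵀ * (single i j 1 * x - x * single i j (1 : ℝ))) := by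
    rw [Fintype.sum_prod_type_right]
    simp only [trace, diag_apply, Matrix.mul_apply, transpose_apply, commutatorCLM_apply]
  have h2 : trace (xᵀ * (single i j 1 * x - x * single i j (1 : ℝ))) =
      trace (single i j (1 : ℝ) * (x * xᵀ - xᵀ * x)) := by
    rw [mul_sub, mul_sub, trace_sub, trace_sub, trace_mul_comm, mul_assoc, ← mul_assoc xᵀ,
      trace_mul_comm (xᵀ * x)]
  rw [h1, h2, trace_single_mul]
  simp

theorem polynomialFun_reflectionHom (j : κ) (P : MvPolynomial (κ × κ) ℂ) (x : Matrix κ κ ℝ) :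
    polynomialFun (reflectionHom j P) x =
      polynomialFun P (reflectionMatrix ℝ j * x * reflectionMatrix ℝ j) := by
  rw [polynomialFun, reflectionHom, MvPolynomial.eval_aeval, polynomialFun]
  congr 2
  funext p
  simp only [reflectionMatrix_conj_apply]
  split_ifs <;> simp

theorem map_polynomialFun_mul_gaussian_eq_zero (D : 𝓢(Matrix κ κ ℝ, ℂ) →L[ℂ] ℂ)
    (hD : ∀ (g : (Matrix κ κ ℝ)ˣ) (φ ψ : 𝓢(Matrix κ κ ℝ, ℂ)),
      (∀ x, ψ x = φ ((g : Matrix κ κ ℝ) * x * (↑g⁻¹ : Matrix κ κ ℝ))) → D ψ = D φ)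
    (hDt : ∀ φ ψ : 𝓢(Matrix κ κ ℝ, ℂ), (∀ x, ψ x = φ xᵀ) → D ψ = - D φ) {ε : ℝ} (hε : 0 < ε)
    (P : MvPolynomial (κ × κ) ℂ) (φ : 𝓢(Matrix κ κ ℝ, ℂ)) (hφ : ∀ x, φ x =
      polynomialFun P x * (Real.exp (-(ε * ∑ p : κ × κ, x p.1 p.2 ^ 2)) : ℝ)) : D φ = 0 := by
  obtain ⟨G, hG⟩ := exists_schwartzMap_matrix_gaussian κ hε
  let m (P : MvPolynomial (κ × κ) ℂ) : 𝓢(Matrix κ κ ℝ, ℂ) := smulLeftCLM ℂ (polynomialFun P) G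
  have hm (P : MvPolynomial (κ × κ) ℂ) (x : Matrix κ κ ℝ) : m P x =
      polynomialFun P x * (Real.exp (-(ε * ∑ p : κ × κ, x p.1 p.2 ^ 2)) : ℝ) := by
    rw [← hG]
    exact smulLeftCLM_apply_apply (hasTemperateGrowth_polynomialFun P) G x
  let ℓ : MvPolynomial (κ × κ) ℂ →ₗ[ℂ] ℂ :=
    { toFun := fun P => D (m P)
      map_add' := fun P Q => by
        rw [← map_add]
        congr 1
        ext x
        simp only [_root_.add_apply, hm, polynomialFun, map_add, add_mul]
      map_smul' := fun c P => by
        rw [RingHom.id_apply, ← map_smul]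
        congr 1
        ext x
        simp only [_root_.smul_apply, hm, polynomialFun, MvPolynomial.smul_eval, smul_eq_mul,
          mul_assoc] }
  have hℓ (P : MvPolynomial (κ × κ) ℂ) : ℓ P = D (m P) := rfl
  have h0 : ℓ = 0 := by
    refine linearMap_eq_zero_of_gaussian_invariant ℓ (c := (2 * ε : ℝ))
      (by exact_mod_cast (by positivity : 2 * ε ≠ 0)) (fun i j Q => ?_) (fun Q => ?_)
      fun j Q => ?_
    · have h1 : conjDeriv (single i j 1) (m Q) = m (commutatorDerivation i j Q) -
          ((2 * ε : ℝ) : ℂ) • m (Q * genericCommutator κ j i) := by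
        ext x
        rw [conjDeriv_apply, _root_.sub_apply, _root_.smul_apply]
        set v := commutatorCLM (single i j 1) x with hv
        refine ((m Q).hasDerivAt_comp_add_smul x v).unique ?_
        have h2 (p : κ × κ) : HasDerivAt (fun t : ℝ => (x + t • v) p.1 p.2) (v p.1 p.2) 0 := by
          simpa using ((hasDerivAt_id (0 : ℝ)).mul_const (v p.1 p.2)).const_add (x p.1 p.2)
        have h3 := MvPolynomial.hasDerivAt_eval (fun p => (h2 p).ofReal_comp) Q
        have h4 : HasDerivAt (fun t : ℝ => ∑ p : κ × κ, (x + t • v) p.1 p.2 ^ 2) _ 0 :=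
          HasDerivAt.fun_sum fun p _ => (h2 p).fun_pow 2
        have h5 := h3.fun_mul (((h4.const_mul ε).fun_neg).exp).ofReal_comp
        simp only [hm]
        refine h5.congr_deriv ?_
        have h6 := sum_mul_commutatorCLM_single i j x
        rw [← hv] at h6
        have h7 : ∑ p : κ × κ, (2 : ℕ) * x p.1 p.2 ^ (2 - 1) * v p.1 p.2 =
            2 * (x * xᵀ - xᵀ * x) j i := by
          rw [← h6, Finset.mul_sum]
          exact Finset.sum_congr rfl fun p _ => by simp [mul_assoc]
        have h8 : polynomialFun (Q * genericCommutator κ j i) x =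
            polynomialFun Q x * ((x * xᵀ - xᵀ * x) j i : ℝ) := by
          rw [← polynomialFun_genericCommutator]
          simp [polynomialFun]
        rw [h8, polynomialFun_commutatorDerivation, ← hv]
        simp only [zero_smul, add_zero, h7, polynomialFun, smul_eq_mul]
        push_cast
        ring
      have h2 := map_conjDeriv_eq_zero D hD (single i j 1) (m Q)
      rw [h1, map_sub, map_smul, sub_eq_zero, smul_eq_mul] at h2
      exact h2
    · rw [hℓ, hℓ]
      refine hDt _ _ fun x => ?_
      rw [hm, hm, polynomialFun_transposeHom]
      congr 5
      exact Fintype.sum_equiv (Equiv.prodComm κ κ) _ _ fun p => rfl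
    · rw [hℓ, hℓ]
      refine hD ⟨reflectionMatrix ℝ j, reflectionMatrix ℝ j, reflectionMatrix_mul_self j,
        reflectionMatrix_mul_self j⟩ _ _ fun x => ?_
      change _ = m Q (reflectionMatrix ℝ j * x * reflectionMatrix ℝ j)
      rw [hm, hm, polynomialFun_reflectionHom]
      congr 5
      refine Finset.sum_congr rfl fun p _ => ?_
      rw [reflectionMatrix_conj_apply]
      split_ifs <;> simp
  have h1 : φ = m P := by
    ext x
    rw [hφ, hm]
  rw [h1, ← hℓ, h0, LinearMap.zero_apply]

theorem map_eq_zero_of_conj_of_transpose (D : 𝓢(Matrix κ κ ℝ, ℂ) →L[ℂ] ℂ)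
    (hD : ∀ (g : (Matrix κ κ ℝ)ˣ) (φ ψ : 𝓢(Matrix κ κ ℝ, ℂ)),
      (∀ x, ψ x = φ ((g : Matrix κ κ ℝ) * x * (↑g⁻¹ : Matrix κ κ ℝ))) → D ψ = D φ)
    (hDt : ∀ φ ψ : 𝓢(Matrix κ κ ℝ, ℂ), (∀ x, ψ x = φ xᵀ) → D ψ = - D φ)
    (φ : 𝓢(Matrix κ κ ℝ, ℂ)) : D φ = 0 := by
  let e : Matrix κ κ ℝ ≃L[ℝ] EuclideanSpace ℝ (κ × κ) := LinearEquiv.toContinuousLinearEquiv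
    ((LinearEquiv.curry ℝ ℝ κ κ).symm ≪≫ₗ (WithLp.linearEquiv 2 ℝ (κ × κ → ℝ)).symm)
  have he (x : Matrix κ κ ℝ) (p : κ × κ) : e x p = x p.1 p.2 := rfl
  have h := map_eq_zero_of_pow_inner_mul_gaussian (D ∘L compCLMOfContinuousLinearEquiv ℂ e)
    (fun ε hε ξ k ψ hψ => ?_) (compCLMOfContinuousLinearEquiv ℂ e.symm φ)
  · rw [← h, ContinuousLinearMap.comp_apply]
    congr 1
  · refine map_polynomialFun_mul_gaussian_eq_zero D hD hDt hε
      ((∑ p, MvPolynomial.C (ξ p : ℂ) * MvPolynomial.X p) ^ k) _ fun x => ?_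
    have h1 : (inner ℝ ξ (e x) : ℂ) ^ k = polynomialFun
        ((∑ p, MvPolynomial.C (ξ p : ℂ) * MvPolynomial.X p) ^ k) x := by
      simp [polynomialFun, PiLp.inner_apply, he, mul_comm]
    have h2 : ‖e x‖ ^ 2 = ∑ p : κ × κ, x p.1 p.2 ^ 2 := by
      simp [EuclideanSpace.norm_sq_eq, he]
    rw [← h1, ← h2]
    exact hψ (e x)

end

theorem conjugation_invariant_tempered_distribution_transpose_invariant_real
    (n : ℕ) (hn : 0 < n)
    (T : 𝓢(Matrix (Fin n) (Fin n) ℝ, ℂ) →L[ℂ] ℂ)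
    (hconj : ∀ (g : (Matrix (Fin n) (Fin n) ℝ)ˣ)
      (φ ψ : 𝓢(Matrix (Fin n) (Fin n) ℝ, ℂ)),
      (∀ x : Matrix (Fin n) (Fin n) ℝ,
        ψ x = φ ((g : Matrix (Fin n) (Fin n) ℝ) * x *
          (↑g⁻¹ : Matrix (Fin n) (Fin n) ℝ))) → T ψ = T φ) :
    ∀ (φ ψ : 𝓢(Matrix (Fin n) (Fin n) ℝ, ℂ)),
      (∀ x : Matrix (Fin n) (Fin n) ℝ, ψ x = φ xᵀ) → T ψ = T φ := by
  intro φ ψ hψ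
  let e : Matrix (Fin n) (Fin n) ℝ ≃L[ℝ] Matrix (Fin n) (Fin n) ℝ :=
    (transposeLinearEquiv (Fin n) (Fin n) ℝ ℝ).toContinuousLinearEquiv
  let A : 𝓢(Matrix (Fin n) (Fin n) ℝ, ℂ) →L[ℂ] 𝓢(Matrix (Fin n) (Fin n) ℝ, ℂ) :=
    compCLMOfContinuousLinearEquiv ℂ e
  have hA (φ : 𝓢(Matrix (Fin n) (Fin n) ℝ, ℂ)) (x : Matrix (Fin n) (Fin n) ℝ) :
      A φ x = φ xᵀ := rfl
  have h := map_eq_zero_of_conj_of_transpose (T - T ∘L A) (fun g φ ψ h => ?_) (fun φ ψ h => ?_) φ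
  · rw [_root_.sub_apply, ContinuousLinearMap.comp_apply, sub_eq_zero] at h
    rw [h]
    congr 1
    ext x
    rw [hψ, hA]
  · rw [_root_.sub_apply, _root_.sub_apply, ContinuousLinearMap.comp_apply,
      ContinuousLinearMap.comp_apply, hconj g φ ψ h]
    congr 1
    let g' : (Matrix (Fin n) (Fin n) ℝ)ˣ :=
      ⟨(↑g⁻¹ : Matrix (Fin n) (Fin n) ℝ)ᵀ, (g : Matrix (Fin n) (Fin n) ℝ)ᵀ,
        by rw [← transpose_mul, g.mul_inv, transpose_one],
        by rw [← transpose_mul, g.inv_mul, transpose_one]⟩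
    refine hconj g' _ _ fun x => ?_
    change A ψ x = A φ ((↑g⁻¹ : Matrix (Fin n) (Fin n) ℝ)ᵀ * x *
      (g : Matrix (Fin n) (Fin n) ℝ)ᵀ)
    rw [hA, hA, h]
    simp [transpose_mul, mul_assoc]
  · have h1 : ψ = A φ := by
      ext x
      rw [h, hA]
    have h2 : A ψ = φ := by
      ext x
      rw [hA, h, transpose_transpose]
    rw [_root_.sub_apply, _root_.sub_apply, ContinuousLinearMap.comp_apply,
      ContinuousLinearMap.comp_apply, h2, ← h1, neg_sub]
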